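/- arXiv:hep-th/9610061 — 3 statements merged into one kernel-verified Lean document; each statement's English description precedes it below -/
import Mathlib

section
/- Let x be either the relativistic map x_R(y) = −e^{−y} or the CGHS map x_C(y) = −log(1 + e^{−y}). There exists a constant C > 0, independent of f and g, such that for every normalized outgoing wave function f and every normalized incoming wave function g, N̄_g[f] ≤ C ∫_0^∞ |f̂(p)|²/(2p(1 − e^{−2πp})) dp (an inequality in [0, ∞]). -/
open MeasureTheory Set Filter
open scoped ENNReal

/-- The Fourier transform `f̂(p) = (2π)^{-1/2} ∫ f(y) e^{-ipy} dy`. -/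
noncomputable def ft (f : ℝ → ℂ) (p : ℝ) : ℂ :=
  (Real.sqrt (2 * Real.pi) : ℂ)⁻¹ *
    ∫ y : ℝ, f y * Complex.exp (-Complex.I * (p : ℂ) * (y : ℂ))

/-- `F̌(k) = (2π)^{-1/2} ∫ f(y) e^{-ik x(y)} dy`. -/
noncomputable def Fk (x : ℝ → ℝ) (f : ℝ → ℂ) (k : ℝ) : ℂ :=
  (Real.sqrt (2 * Real.pi) : ℂ)⁻¹ *
    ∫ y : ℝ, f y * Complex.exp (-Complex.I * (k : ℂ) * (x y : ℂ))

/-- The relativistic black-hole coordinate map `x_R(y) = -e^{-y}`. -/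
noncomputable def xR (y : ℝ) : ℝ := -Real.exp (-y)

/-- The CGHS black-hole coordinate map `x_C(y) = -log(1+e^{-y})`. -/
noncomputable def xC (y : ℝ) : ℝ := -Real.log (1 + Real.exp (-y))

/-- The mean number of spontaneously created particles `N̄_o[f]`. -/
noncomputable def No (x : ℝ → ℝ) (f : ℝ → ℂ) : ℝ≥0∞ :=
  ∫⁻ k in Set.Ioi (0:ℝ), ENNReal.ofReal (‖Fk x f (-k)‖ ^ 2 / (2 * k))

/-- The thermal mean particle number `N̄^Th_β[f]` at inverse temperature `β`. -/
noncomputable def Nth (β : ℝ) (f : ℝ → ℂ) : ℝ≥0∞ :=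
  ∫⁻ p in Set.Ioi (0:ℝ),
    ENNReal.ofReal (‖ft f p‖ ^ 2 / (2 * p * (Real.exp (β * p) - 1)))

/-- translate of `f` by `y₀`. -/
noncomputable def tr (f : ℝ → ℂ) (y₀ : ℝ) : ℝ → ℂ := fun y => f (y - y₀)

/-- `⟨g̃, Af̃⟩ = ∫_0^∞ conj(ĝ(k)) F̌(k)/(2k) dk`. -/
noncomputable def Aip (x : ℝ → ℝ) (g f : ℝ → ℂ) : ℂ :=
  ∫ k in Set.Ioi (0:ℝ), (starRingEnd ℂ) (ft g k) * Fk x f k / (2 * (k : ℂ))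

/-- `⟨g̃*, Bf̃⟩ = ∫_0^∞ ĝ(k) F̌(-k)/(2k) dk`. -/
noncomputable def Bip (x : ℝ → ℝ) (g f : ℝ → ℂ) : ℂ :=
  ∫ k in Set.Ioi (0:ℝ), ft g k * Fk x f (-k) / (2 * (k : ℂ))

/-- Wald's formula: the mean number of particles emitted when the incoming state is
the one-particle state `Ω_g`:  `N̄_g[f] = N̄_o[f] + |⟨g̃,Af̃⟩|² + |⟨g̃*,Bf̃⟩|²`. -/
noncomputable def Ng (x : ℝ → ℝ) (g f : ℝ → ℂ) : ℝ≥0∞ :=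
  No x f + ENNReal.ofReal (‖Aip x g f‖ ^ 2) + ENNReal.ofReal (‖Bip x g f‖ ^ 2)

open FourierTransform SchwartzMap in
theorem fourier_toLp_ae_eq {f : ℝ → ℂ} (hf : Integrable f) (hf2 : MemLp f 2) :
    ((𝓕 (hf2.toLp f) : Lp ℂ 2 (volume : Measure ℝ)) : ℝ → ℂ) =ᵐ[volume] 𝓕 f := by
  have hcont : Continuous (𝓕 f) :=
    VectorFourier.fourierIntegral_continuous Real.continuous_fourierChar
      (innerSL ℝ).continuous₂ hf
  apply ae_eq_of_integral_contDiff_smul_eq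
  · exact (Lp.memLp _).locallyIntegrable (by norm_num)
  · exact hcont.locallyIntegrable
  intro g hg hgs
  have hg' : ContDiff ℝ (⊤ : ℕ∞) (fun x => (g x : ℂ)) := Complex.ofRealCLM.contDiff.comp hg
  have hgs' : HasCompactSupport (fun x => (g x : ℂ)) := hgs.comp_left (g := ((↑) : ℝ → ℂ)) rfl
  set φ : 𝓢(ℝ, ℂ) := hgs'.toSchwartzMap hg' with hφ
  have hφv : ∀ x, φ x = (g x : ℂ) := fun x => rfl
  have key := congrArg (fun T => T φ)
    (MeasureTheory.Lp.fourier_toTemperedDistribution_eq (hf2.toLp f))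
  simp only [TemperedDistribution.fourier_apply, Lp.toTemperedDistribution_apply] at key
  have e1 : ∫ x, g x • ((𝓕 (hf2.toLp f) : Lp ℂ 2 (volume : Measure ℝ)) : ℝ → ℂ) x =
      ∫ x, (𝓕 φ) x • f x := by
    simp only [← Complex.coe_smul, ← hφv]
    rw [← key]
    apply integral_congr_ae
    filter_upwards [hf2.coeFn_toLp] with x hx
    rw [hx]
  have e2 : ∫ x, (𝓕 φ) x • f x = ∫ x, φ x • 𝓕 f x := by
    rw [SchwartzMap.fourier_coe]
    have := VectorFourier.integral_fourierIntegral_smul_eq_flip (μ := volume) (ν := volume)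
      (f := (φ : ℝ → ℂ)) (g := f) (L := innerₗ ℝ) Real.continuous_fourierChar
      (innerSL ℝ).continuous₂ φ.integrable hf
    rw [flip_innerₗ] at this
    exact this
  rw [e1, e2]
  simp only [← Complex.coe_smul, ← hφv]

theorem lintegral_comp_mul_left (g : ℝ → ℝ≥0∞) {a : ℝ} (ha : a ≠ 0) :
    ∫⁻ x, g (a * x) = ENNReal.ofReal |a⁻¹| * ∫⁻ x, g x := by
  rw [← (measurableEmbedding_mulLeft₀ ha).lintegral_map, Real.map_volume_mul_left ha,
    lintegral_smul_measure, smul_eq_mul]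

open FourierTransform in
theorem lintegral_enorm_sq_ft {f : ℝ → ℂ} (hf : Integrable f) (hf2 : MemLp f 2) :
    ∫⁻ p, ‖ft f p‖ₑ ^ 2 = ∫⁻ x, ‖f x‖ₑ ^ 2 := by
  have h1 : ∀ p, ft f p = (Real.sqrt (2 * Real.pi) : ℂ)⁻¹ * 𝓕 f ((2 * Real.pi)⁻¹ * p) := by
    intro p
    rw [Real.fourier_real_eq_integral_exp_smul, ft]
    congr 2
    ext y
    rw [smul_eq_mul, mul_comm]
    congr 2
    push_cast
    field_simp
  have h2 : ∫⁻ p, ‖𝓕 f p‖ₑ ^ 2 = ∫⁻ x, ‖f x‖ₑ ^ 2 := by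
    have e := Lp.norm_fourier_eq (hf2.toLp f)
    rw [Lp.norm_def, Lp.norm_def, ENNReal.toReal_eq_toReal_iff' (Lp.eLpNorm_ne_top _)
      (Lp.eLpNorm_ne_top _), eLpNorm_congr_ae (fourier_toLp_ae_eq hf hf2),
      eLpNorm_congr_ae hf2.coeFn_toLp,
      eLpNorm_eq_lintegral_rpow_enorm_toReal (by norm_num) (by norm_num),
      eLpNorm_eq_lintegral_rpow_enorm_toReal (by norm_num) (by norm_num)] at e
    have := congrArg (fun z : ℝ≥0∞ => z ^ (2 : ℝ)) e
    simp only [← ENNReal.rpow_mul] at this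
    simpa using this
  have h3 : ∀ p, ‖ft f p‖ₑ ^ 2 =
      ENNReal.ofReal (2 * Real.pi)⁻¹ * ‖𝓕 f ((2 * Real.pi)⁻¹ * p)‖ₑ ^ 2 := by
    intro p
    rw [h1, enorm_mul, mul_pow]
    congr 1
    rw [← ofReal_norm, ← ENNReal.ofReal_pow (norm_nonneg _)]
    congr 1
    rw [norm_inv, Complex.norm_real, Real.norm_of_nonneg (Real.sqrt_nonneg _), inv_pow,
      Real.sq_sqrt (by positivity)]
  simp_rw [h3]
  rw [lintegral_const_mul' _ _ ENNReal.ofReal_ne_top,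
    lintegral_comp_mul_left (fun p => ‖𝓕 f p‖ₑ ^ 2) (by positivity), h2, ← mul_assoc,
    ← ENNReal.ofReal_mul (by positivity), inv_inv, abs_of_pos (by positivity),
    inv_mul_cancel₀ (by positivity)]
  simp

/-- The primitive of the push-forward of `f(y) dy` under `X`. -/
noncomputable def pushPrimitive (X : ℝ → ℝ) (f : ℝ → ℂ) (x : ℝ) : ℂ :=
  ∫ y in {y | X y ≤ x}, f y

theorem measurable_pushPrimitive {X : ℝ → ℝ} (hX : Measurable X) {f : ℝ → ℂ}
    (hf : Integrable f) : Measurable (pushPrimitive X f) := by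
  obtain ⟨g, hg, hfg⟩ := hf.1
  have : pushPrimitive X f = fun x => ∫ y, {z : ℝ × ℝ | X z.2 ≤ z.1}.indicator
      (fun z => g z.2) (x, y) := by
    ext x
    rw [pushPrimitive, ← integral_indicator (measurableSet_le hX measurable_const)]
    apply integral_congr_ae
    filter_upwards [hfg] with y hy
    by_cases h : X y ≤ x <;> simp [indicator, h, hy]
  rw [this]
  apply StronglyMeasurable.measurable
  apply StronglyMeasurable.integral_prod_right'
  exact (hg.comp_measurable measurable_snd).indicator
    (measurableSet_le (hX.comp measurable_snd) measurable_fst)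

theorem pushPrimitive_add_sub {X : ℝ → ℝ} (hX : Measurable X) {f : ℝ → ℂ}
    (hf : Integrable f) {t : ℝ} (ht : 0 ≤ t) (x : ℝ) :
    pushPrimitive X f (x + t) - pushPrimitive X f x =
      ∫ y, {z : ℝ × ℝ | z.1 < X z.2 ∧ X z.2 ≤ z.1 + t}.indicator (fun z => f z.2) (x, y) := by
  have hs : ∀ a, MeasurableSet {y | X y ≤ a} := fun a => measurableSet_le hX measurable_const
  rw [pushPrimitive, pushPrimitive, ← integral_indicator (hs _), ← integral_indicator (hs _),
    ← integral_sub (hf.indicator (hs _)) (hf.indicator (hs _))]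
  congr 1 with y
  by_cases h1 : X y ≤ x
  · have h2 : X y ≤ x + t := by linarith
    simp [indicator, h1, h2, not_lt.mpr h1]
  · by_cases h2 : X y ≤ x + t <;> simp [indicator, h1, h2, not_le.mp h1]

theorem norm_pushPrimitive_le {X : ℝ → ℝ} {f : ℝ → ℂ} (hf : Integrable f) (x : ℝ) :
    ‖pushPrimitive X f x‖ ≤ ∫ y, ‖f y‖ :=
  (norm_integral_le_integral_norm _).trans
    (setIntegral_le_integral hf.norm (ae_of_all _ fun _ => norm_nonneg _))

theorem integrable_strip {X : ℝ → ℝ} (hX : Measurable X) {f : ℝ → ℂ}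
    (hf : Integrable f) (t : ℝ) :
    Integrable ({z : ℝ × ℝ | z.1 < X z.2 ∧ X z.2 ≤ z.1 + t}.indicator (fun z => f z.2))
      (volume.prod volume) := by
  have hms : MeasurableSet {z : ℝ × ℝ | z.1 < X z.2 ∧ X z.2 ≤ z.1 + t} :=
    (measurableSet_lt measurable_fst (hX.comp measurable_snd)).inter
      (measurableSet_le (hX.comp measurable_snd) (measurable_fst.add_const t))
  have hslice : ∀ y, (fun x => {z : ℝ × ℝ | z.1 < X z.2 ∧ X z.2 ≤ z.1 + t}.indicator
      (fun z => f z.2) (x, y)) = (Ico (X y - t) (X y)).indicator (fun _ => f y) := by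
    intro y
    ext x
    simp only [indicator, mem_ofPred_eq, mem_Ico, sub_le_iff_le_add, and_comm]
  rw [integrable_prod_iff' (hf.1.comp_snd.indicator hms)]
  constructor
  · refine ae_of_all _ fun y => ?_
    rw [hslice]
    exact (integrable_indicator_iff measurableSet_Ico).mpr (integrableOn_const (by simp) (by simp))
  · have : (fun y => ∫ x, ‖{z : ℝ × ℝ | z.1 < X z.2 ∧ X z.2 ≤ z.1 + t}.indicator
      (fun z => f z.2) (x, y)‖) = fun y => (max t 0) * ‖f y‖ := by
      ext y
      have := hslice y
      simp_rw [fun x => congrFun this x, norm_indicator_eq_indicator_norm]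
      rw [integral_indicator measurableSet_Ico]
      simp [Measure.real, ENNReal.toReal_ofReal']
    rw [this]
    exact hf.norm.const_mul _

theorem integrable_pushPrimitive_add_sub {X : ℝ → ℝ} (hX : Measurable X) {f : ℝ → ℂ}
    (hf : Integrable f) {t : ℝ} (ht : 0 ≤ t) :
    Integrable (fun x => pushPrimitive X f (x + t) - pushPrimitive X f x) := by
  simp_rw [pushPrimitive_add_sub hX hf ht]
  exact (integrable_strip hX hf t).integral_prod_left

theorem memLp_two_pushPrimitive_add_sub {X : ℝ → ℝ} (hX : Measurable X) {f : ℝ → ℂ}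
    (hf : Integrable f) {t : ℝ} (ht : 0 ≤ t) :
    MemLp (fun x => pushPrimitive X f (x + t) - pushPrimitive X f x) 2 := by
  have hi := integrable_pushPrimitive_add_sub hX hf ht
  rw [memLp_two_iff_integrable_sq_norm hi.1]
  simp_rw [sq]
  refine hi.norm.bdd_mul hi.norm.1 (c := 2 * ∫ y, ‖f y‖) (ae_of_all _ fun x => ?_)
  rw [norm_norm]
  refine (norm_sub_le _ _).trans ?_
  have h1 := norm_pushPrimitive_le (X := X) hf (x + t)
  have h2 := norm_pushPrimitive_le (X := X) hf x
  linarith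

theorem ft_pushPrimitive_add_sub {X : ℝ → ℝ} (hX : Measurable X) {f : ℝ → ℂ}
    (hf : Integrable f) {t : ℝ} (ht : 0 ≤ t) {k : ℝ} (hk : k ≠ 0) :
    ft (fun x => pushPrimitive X f (x + t) - pushPrimitive X f x) k =
      Fk X f k * ((Complex.exp (Complex.I * k * t) - 1) / (Complex.I * k)) := by
  have hinner : ∀ y, ∫ x, {z : ℝ × ℝ | z.1 < X z.2 ∧ X z.2 ≤ z.1 + t}.indicator
      (fun z => f z.2) (x, y) * Complex.exp (-Complex.I * k * x) =
      f y * Complex.exp (-Complex.I * k * X y) *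
        ((Complex.exp (Complex.I * k * t) - 1) / (Complex.I * k)) := by
    intro y
    have : (fun x : ℝ => {z : ℝ × ℝ | z.1 < X z.2 ∧ X z.2 ≤ z.1 + t}.indicator
      (fun z => f z.2) (x, y) * Complex.exp (-Complex.I * k * x)) =
      (Ico (X y - t) (X y)).indicator (fun x : ℝ => f y * Complex.exp (-Complex.I * k * x)) := by
      ext x
      simp only [indicator, mem_ofPred_eq, mem_Ico, sub_le_iff_le_add, and_comm, ite_mul, zero_mul]
    have hc : -Complex.I * (k : ℂ) ≠ 0 := by simp [hk]
    have hc' : (k : ℂ) ≠ 0 := by simp [hk]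
    rw [this, integral_indicator measurableSet_Ico, integral_Ico_eq_integral_Ioc,
      ← intervalIntegral.integral_of_le (by linarith), intervalIntegral.integral_const_mul,
      integral_exp_mul_complex hc]
    have e : Complex.exp (-Complex.I * k * ((X y - t : ℝ) : ℂ)) =
        Complex.exp (-Complex.I * k * X y) * Complex.exp (Complex.I * k * t) := by
      rw [← Complex.exp_add]
      congr 1
      push_cast
      ring
    rw [e]
    field_simp
    ring
  have hint : Integrable (Function.uncurry fun x y =>
      {z : ℝ × ℝ | z.1 < X z.2 ∧ X z.2 ≤ z.1 + t}.indicator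
      (fun z => f z.2) (x, y) * Complex.exp (-Complex.I * k * x)) (volume.prod volume) := by
    refine (integrable_strip hX hf t).mul_bdd (c := 1) ?_ (ae_of_all _ fun z => ?_)
    · apply Continuous.aestronglyMeasurable
      fun_prop
    · rw [show -Complex.I * (k : ℂ) * (z.1 : ℂ) = ((-(k * z.1) : ℝ) : ℂ) * Complex.I by
        push_cast; ring, Complex.norm_exp_ofReal_mul_I]
  rw [ft, Fk]
  simp_rw [pushPrimitive_add_sub hX hf ht, ← integral_mul_const]
  rw [integral_integral_swap hint]
  simp_rw [hinner]
  rw [integral_mul_const]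
  ring

theorem lintegral_pushPrimitive_add_sub {X : ℝ → ℝ} (hX : Measurable X) {f : ℝ → ℂ}
    (hf : Integrable f) {t : ℝ} (ht : 0 ≤ t) :
    ∫⁻ x, ‖pushPrimitive X f (x + t) - pushPrimitive X f x‖ₑ ^ 2 =
      ∫⁻ k, ‖Fk X f k‖ₑ ^ 2 *
        ENNReal.ofReal (‖Complex.exp (Complex.I * ↑(k * t)) - 1‖ ^ 2 / k ^ 2) := by
  rw [← lintegral_enorm_sq_ft (integrable_pushPrimitive_add_sub hX hf ht)
    (memLp_two_pushPrimitive_add_sub hX hf ht)]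
  apply lintegral_congr_ae
  filter_upwards [Measure.ae_ne volume 0] with k hk
  rw [ft_pushPrimitive_add_sub hX hf ht hk, enorm_mul, mul_pow]
  congr 1
  rw [← ofReal_norm, ← ENNReal.ofReal_pow (norm_nonneg _), norm_div, div_pow]
  congr 2
  · push_cast
    rw [mul_assoc]
  · simp

/-- The constant `∫_0^∞ |e^{it} - 1|² / t² dt`. -/
noncomputable def gagliardoConst : ℝ≥0∞ :=
  ∫⁻ t in Ioi (0 : ℝ), ENNReal.ofReal (‖Complex.exp (Complex.I * (t : ℂ)) - 1‖ ^ 2 / t ^ 2)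

theorem gagliardoConst_ne_zero : gagliardoConst ≠ 0 := by
  have hm : Measurable fun t : ℝ =>
      ENNReal.ofReal (‖Complex.exp (Complex.I * (t : ℂ)) - 1‖ ^ 2 / t ^ 2) := by fun_prop
  apply ne_of_gt
  rw [gagliardoConst, setLIntegral_pos_iff hm]
  refine lt_of_lt_of_le ?_ (measure_mono (s := Ioo (0 : ℝ) Real.pi) ?_)
  · simp [Real.pi_pos]
  · intro t ht
    refine ⟨?_, ht.1⟩
    rw [Function.mem_support]
    have h : Complex.exp (Complex.I * (t : ℂ)) - 1 ≠ 0 := by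
      intro h
      have := congrArg Complex.im h
      rw [mul_comm, Complex.exp_mul_I, ← Complex.ofReal_cos, ← Complex.ofReal_sin] at this
      simp at this
      exact (Real.sin_pos_of_pos_of_lt_pi ht.1 ht.2).ne' this
    have h0 := ht.1
    exact (ENNReal.ofReal_pos.mpr (by positivity)).ne'

theorem norm_exp_I_mul_sub_one_sq_le (t : ℝ) :
    ‖Complex.exp (Complex.I * (t : ℂ)) - 1‖ ^ 2 ≤ 4 := by
  have : ‖Complex.exp (Complex.I * (t : ℂ)) - 1‖ ≤ 2 := by
    refine (norm_sub_le _ _).trans ?_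
    rw [Complex.norm_exp_I_mul_ofReal]
    norm_num
  nlinarith [norm_nonneg (Complex.exp (Complex.I * (t : ℂ)) - 1)]

theorem gagliardoConst_ne_top : gagliardoConst ≠ ⊤ := by
  rw [gagliardoConst, ← Ioc_union_Ioi_eq_Ioi (zero_le_one' ℝ)]
  refine ((lintegral_union_le _ _ _).trans_lt (ENNReal.add_lt_top.mpr ⟨?_, ?_⟩)).ne
  · refine (setLIntegral_mono' (g := fun _ => 1) measurableSet_Ioc fun t ht => ?_).trans_lt
      (by simp)
    rw [← ENNReal.ofReal_one]
    apply ENNReal.ofReal_le_ofReal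
    have h0 := ht.1
    rw [div_le_one (by positivity)]
    have := Real.norm_exp_I_mul_ofReal_sub_one_le (x := t)
    rw [← sq_abs t]
    exact pow_le_pow_left₀ (norm_nonneg _) this 2
  · refine (setLIntegral_mono' (g := fun t => ENNReal.ofReal (4 * t ^ (-2 : ℝ))) measurableSet_Ioi
      fun t ht => ?_).trans_lt ?_
    · apply ENNReal.ofReal_le_ofReal
      have h0 : (0 : ℝ) < t := zero_lt_one.trans ht
      rw [Real.rpow_neg h0.le, Real.rpow_two, div_eq_mul_inv]
      gcongr
      exact norm_exp_I_mul_sub_one_sq_le t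
    · exact ((integrableOn_Ioi_rpow_of_lt (by norm_num : (-2 : ℝ) < -1)
        zero_lt_one).const_mul 4).lintegral_lt_top

theorem lintegral_scaled_weight {k : ℝ} (hk : k ≠ 0) :
    ∫⁻ t in Ioi (0 : ℝ), ENNReal.ofReal (1 / t ^ 2) *
      ENNReal.ofReal (‖Complex.exp (Complex.I * ↑(k * t)) - 1‖ ^ 2 / k ^ 2) =
    gagliardoConst * ENNReal.ofReal (1 / |k|) := by
  have hk' : 0 < |k| := abs_pos.mpr hk
  have hS : ∀ t, ‖Complex.exp (Complex.I * ↑(k * t)) - 1‖ =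
      ‖Complex.exp (Complex.I * ↑(|k| * t)) - 1‖ := by
    intro t
    rcases abs_choice k with h | h
    · rw [h]
    · rw [h, ← RCLike.norm_conj]
      congr 1
      rw [map_sub, ← Complex.exp_conj]
      simp
  rw [gagliardoConst, ← lintegral_indicator measurableSet_Ioi,
    ← lintegral_indicator measurableSet_Ioi, mul_comm, one_div, ← abs_of_pos (inv_pos.mpr hk'),
    ← lintegral_comp_mul_left _ hk'.ne']
  congr 1 with t
  by_cases ht : 0 < t
  · have h2 : 0 < |k| * t := by positivity
    rw [indicator_of_mem (show t ∈ Ioi 0 from ht), indicator_of_mem (show |k| * t ∈ Ioi 0 from h2),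
      ← ENNReal.ofReal_mul (by positivity), hS]
    congr 1
    rw [mul_pow, sq_abs]
    field_simp
  · have h2 : ¬ 0 < |k| * t := by
      simpa [hk'] using ht
    rw [indicator_of_notMem (show t ∉ Ioi 0 from ht),
      indicator_of_notMem (show |k| * t ∉ Ioi 0 from h2)]

theorem continuous_Fk {X : ℝ → ℝ} (hX : Measurable X) {f : ℝ → ℂ} (hf : Integrable f) :
    Continuous (Fk X f) := by
  refine continuous_const.mul (continuous_of_dominated (bound := fun y => ‖f y‖) ?_ ?_ hf.norm ?_)
  · intro k
    refine hf.1.mul (Measurable.aestronglyMeasurable ?_)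
    fun_prop
  · refine fun k => ae_of_all _ fun y => ?_
    rw [norm_mul, show -Complex.I * (k : ℂ) * (X y : ℂ) = ((-(k * X y) : ℝ) : ℂ) * Complex.I by
        push_cast; ring, Complex.norm_exp_ofReal_mul_I, mul_one]
  · refine ae_of_all _ fun y => ?_
    fun_prop

theorem lintegral_gagliardo_eq {X : ℝ → ℝ} (hX : Measurable X) {f : ℝ → ℂ} (hf : Integrable f) :
    ∫⁻ t in Ioi (0 : ℝ), ENNReal.ofReal (1 / t ^ 2) *
      ∫⁻ x, ‖pushPrimitive X f (x + t) - pushPrimitive X f x‖ₑ ^ 2 =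
    gagliardoConst * ∫⁻ k, ‖Fk X f k‖ₑ ^ 2 * ENNReal.ofReal (1 / |k|) := by
  have hF : Measurable (Fk X f) := (continuous_Fk hX hf).measurable
  calc _ = ∫⁻ t in Ioi (0 : ℝ), ∫⁻ k, ENNReal.ofReal (1 / t ^ 2) * (‖Fk X f k‖ₑ ^ 2 *
        ENNReal.ofReal (‖Complex.exp (Complex.I * ↑(k * t)) - 1‖ ^ 2 / k ^ 2)) := by
        refine setLIntegral_congr_fun measurableSet_Ioi fun t ht => ?_
        rw [lintegral_pushPrimitive_add_sub hX hf (le_of_lt ht),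
          lintegral_const_mul' _ _ ENNReal.ofReal_ne_top]
    _ = ∫⁻ k, ∫⁻ t in Ioi (0 : ℝ), ENNReal.ofReal (1 / t ^ 2) * (‖Fk X f k‖ₑ ^ 2 *
        ENNReal.ofReal (‖Complex.exp (Complex.I * ↑(k * t)) - 1‖ ^ 2 / k ^ 2)) := by
        apply lintegral_lintegral_swap
        apply Measurable.aemeasurable
        unfold Function.uncurry
        fun_prop
    _ = ∫⁻ k, gagliardoConst * (‖Fk X f k‖ₑ ^ 2 * ENNReal.ofReal (1 / |k|)) := by
        apply lintegral_congr_ae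
        filter_upwards [Measure.ae_ne volume 0] with k hk
        simp_rw [mul_left_comm _ (‖Fk X f k‖ₑ ^ 2)]
        rw [lintegral_const_mul' _ _ (by finiteness), lintegral_scaled_weight hk]
    _ = _ := lintegral_const_mul' _ _ gagliardoConst_ne_top

theorem lintegral_gagliardo_swap {P : ℝ → ℂ} (hP : Measurable P) :
    ∫⁻ t in Ioi (0 : ℝ), ENNReal.ofReal (1 / t ^ 2) * ∫⁻ x, ‖P (x + t) - P x‖ₑ ^ 2 =
    ∫⁻ x, ∫⁻ x' in Ioi x, ENNReal.ofReal (1 / (x' - x) ^ 2) * ‖P x' - P x‖ₑ ^ 2 := by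
  simp_rw [← lintegral_const_mul' _ _ ENNReal.ofReal_ne_top]
  rw [lintegral_lintegral_swap (by
    apply Measurable.aemeasurable
    unfold Function.uncurry
    fun_prop)]
  congr 1 with x
  rw [← lintegral_indicator measurableSet_Ioi, ← lintegral_indicator measurableSet_Ioi]
  conv_rhs => rw [← lintegral_add_left_eq_self _ x]
  congr 1 with t
  by_cases ht : 0 < t <;> simp [indicator, ht]

theorem lintegral_Ici_zero_inv_sq {x : ℝ} (hx : x < 0) :
    ∫⁻ x' in Ici (0 : ℝ), ENNReal.ofReal (1 / (x' - x) ^ 2) = ENNReal.ofReal (1 / -x) := by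
  have h : ∀ x' ∈ Ici (0 : ℝ), ENNReal.ofReal (1 / (x' - x) ^ 2) =
      (Ici (-x)).indicator (fun u => ENNReal.ofReal (u ^ (-2 : ℝ))) (-x + x') := by
    intro x' hx'
    have h0 : (0 : ℝ) ≤ x' := hx'
    rw [indicator_of_mem (by simpa using h0), Real.rpow_neg (by linarith), Real.rpow_two,
      one_div, sub_eq_neg_add]
  have h2 : ∀ x', (Ici (0 : ℝ)).indicator (fun x' => ENNReal.ofReal (1 / (x' - x) ^ 2)) x' =
      (Ici (-x)).indicator (fun u => ENNReal.ofReal (u ^ (-2 : ℝ))) (-x + x') := by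
    intro x'
    by_cases hx' : x' ∈ Ici (0 : ℝ)
    · rw [indicator_of_mem hx', h x' hx']
    · rw [indicator_of_notMem hx', indicator_of_notMem (by simpa using hx')]
  rw [← lintegral_indicator measurableSet_Ici]
  simp_rw [h2]
  rw [lintegral_add_left_eq_self (fun u => (Ici (-x)).indicator
    (fun u => ENNReal.ofReal (u ^ (-2 : ℝ))) u) (-x), lintegral_indicator measurableSet_Ici,
    setLIntegral_congr Ioi_ae_eq_Ici.symm, ← ofReal_integral_eq_lintegral_ofReal
      (integrableOn_Ioi_rpow_of_lt (by norm_num) (by linarith)),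
    integral_Ioi_rpow_of_lt (by norm_num) (by linarith)]
  · congr 1
    rw [show (-2 : ℝ) + 1 = -1 by norm_num, Real.rpow_neg_one]
    simp [div_neg]
  · filter_upwards [ae_restrict_mem measurableSet_Ioi] with u hu
    exact Real.rpow_nonneg (by linarith [mem_Ioi.mp hu]) _

theorem lintegral_gagliardo_comp_le {X φ : ℝ → ℝ} (hder : ∀ y, HasDerivAt X (φ y) y)
    (hφ : ∀ y, 0 < φ y) (hrange : range X = Iio 0) (hloc : ∀ y, φ y ≤ -X y)
    (hgeo : ∀ y y', y < y' → φ y * φ y' * (y' - y) ^ 2 ≤ (X y' - X y) ^ 2)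
    {f : ℝ → ℂ} (hf : Integrable f) (hf0 : ∫ y, f y = 0) :
    ∫⁻ x, ∫⁻ x' in Ioi x, ENNReal.ofReal (1 / (x' - x) ^ 2) *
      ‖pushPrimitive X f x' - pushPrimitive X f x‖ₑ ^ 2 ≤
    (∫⁻ x, ∫⁻ x' in Ioi x, ENNReal.ofReal (1 / (x' - x) ^ 2) *
      ‖pushPrimitive id f x' - pushPrimitive id f x‖ₑ ^ 2) +
      ∫⁻ x, ‖pushPrimitive id f x‖ₑ ^ 2 := by
  have hmono : StrictMono X := strictMono_of_hasDerivAt_pos hder hφ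
  have hneg : ∀ y, X y < 0 := fun y => by
    have : X y ∈ Iio 0 := hrange ▸ mem_range_self y
    exact this
  have hpos : ∀ x, 0 ≤ x → pushPrimitive X f x = 0 := by
    intro x hx
    have : {y | X y ≤ x} = univ := by
      ext y
      simpa using (hneg y).le.trans hx
    rw [pushPrimitive, this, setIntegral_univ, hf0]
  have hcomp : ∀ y, pushPrimitive X f (X y) = pushPrimitive id f y := by
    intro y
    simp only [pushPrimitive, hmono.le_iff_le, id]
  have hsplit : ∀ x < 0, ∫⁻ x' in Ioi x, ENNReal.ofReal (1 / (x' - x) ^ 2) *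
      ‖pushPrimitive X f x' - pushPrimitive X f x‖ₑ ^ 2 =
      (∫⁻ x' in Ioo x 0, ENNReal.ofReal (1 / (x' - x) ^ 2) *
      ‖pushPrimitive X f x' - pushPrimitive X f x‖ₑ ^ 2) +
      ENNReal.ofReal (1 / -x) * ‖pushPrimitive X f x‖ₑ ^ 2 := by
    intro x hx
    rw [← Ioo_union_Ici_eq_Ioi hx, lintegral_union measurableSet_Ici
      (by
        rw [Set.disjoint_left]
        exact fun a ha hb => not_le.mpr ha.2 hb)]
    congr 1
    rw [← lintegral_Ici_zero_inv_sq hx, ← lintegral_mul_const' _ _ (by finiteness)]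
    refine setLIntegral_congr_fun measurableSet_Ici fun x' hx' => ?_
    simp [hpos x' hx']
  have hzero : ∫⁻ x in (Iio 0)ᶜ, ∫⁻ x' in Ioi x, ENNReal.ofReal (1 / (x' - x) ^ 2) *
      ‖pushPrimitive X f x' - pushPrimitive X f x‖ₑ ^ 2 = 0 := by
    rw [setLIntegral_congr_fun (g := fun _ => 0) measurableSet_Iio.compl fun x hx => ?_]
    · simp
    · have hx : 0 ≤ x := by simpa using hx
      rw [setLIntegral_congr_fun (g := fun _ => 0) measurableSet_Ioi fun x' hx' => ?_]
      · simp
      · simp [hpos x hx, hpos x' (hx.trans (le_of_lt hx'))]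
  have himage : ∀ y, Ioo (X y) 0 = X '' Ioi y := by
    intro y
    ext x
    constructor
    · intro hx
      obtain ⟨z, rfl⟩ : x ∈ range X := hrange ▸ hx.2
      exact ⟨z, hmono.lt_iff_lt.mp hx.1, rfl⟩
    · rintro ⟨z, hz, rfl⟩
      exact ⟨hmono hz, hneg z⟩
  have hrange' : Iio 0 = X '' univ := by rw [image_univ, hrange]
  rw [← lintegral_add_compl _ (measurableSet_Iio (a := (0 : ℝ))), hzero, add_zero,
    setLIntegral_congr_fun measurableSet_Iio hsplit, hrange',
    lintegral_image_eq_lintegral_abs_deriv_mul MeasurableSet.univ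
      (fun y _ => (hder y).hasDerivWithinAt) hmono.injective.injOn, setLIntegral_univ,
    ← lintegral_add_right _ ((measurable_pushPrimitive measurable_id hf).enorm.pow_const 2)]
  refine lintegral_mono fun y => ?_
  simp only
  rw [mul_add, hcomp, himage, lintegral_image_eq_lintegral_abs_deriv_mul measurableSet_Ioi
      (fun y _ => (hder y).hasDerivWithinAt) hmono.injective.injOn]
  refine add_le_add ?_ ?_
  · rw [← lintegral_const_mul' _ _ ENNReal.ofReal_ne_top]
    refine setLIntegral_mono' measurableSet_Ioi fun y' hy' => ?_
    rw [hcomp, ← mul_assoc, ← mul_assoc, abs_of_pos (hφ y), abs_of_pos (hφ y'),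
      ← ENNReal.ofReal_mul (hφ y).le, ← ENNReal.ofReal_mul (mul_pos (hφ y) (hφ y')).le]
    refine mul_le_mul_left (ENNReal.ofReal_le_ofReal ?_) _
    have h1 : 0 < y' - y := sub_pos.mpr hy'
    have h2 : 0 < X y' - X y := sub_pos.mpr (hmono hy')
    rw [mul_one_div, div_le_div_iff₀ (by positivity) (by positivity), one_mul]
    exact hgeo y y' hy'
  · rw [← mul_assoc, abs_of_pos (hφ y), ← ENNReal.ofReal_mul (hφ y).le]
    refine mul_le_of_le_one_left zero_le ?_
    rw [← ENNReal.ofReal_one]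
    apply ENNReal.ofReal_le_ofReal
    rw [mul_one_div, div_le_one (by linarith [hneg y])]
    exact hloc y

theorem lintegral_pushPrimitive_sq_le {f : ℝ → ℂ} (hf : Integrable f) (hf0 : ∫ y, f y = 0) :
    ∫⁻ x, ‖pushPrimitive id f x‖ₑ ^ 2 ≤
      4 * ∫⁻ p, ‖Fk id f p‖ₑ ^ 2 * ENNReal.ofReal (1 / p ^ 2) := by
  have hP : Measurable (pushPrimitive id f) := measurable_pushPrimitive measurable_id hf
  have hlim : ∀ x, Tendsto (fun n : ℕ => pushPrimitive id f (x + n)) atTop (nhds 0) := by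
    intro x
    have h := (aecover_Iic (μ := volume) (tendsto_atTop_add_const_left atTop x
      tendsto_natCast_atTop_atTop)).integral_tendsto_of_countably_generated hf
    rwa [hf0] at h
  calc _ = ∫⁻ x, liminf (fun n : ℕ =>
        ‖pushPrimitive id f (x + n) - pushPrimitive id f x‖ₑ ^ 2) atTop := by
        congr 1 with x
        have h := ((hlim x).sub_const (pushPrimitive id f x)).enorm
        rw [(ENNReal.Tendsto.pow (n := 2) h).liminf_eq]
        simp
    _ ≤ liminf (fun n : ℕ => ∫⁻ x,
        ‖pushPrimitive id f (x + n) - pushPrimitive id f x‖ₑ ^ 2) atTop :=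
        lintegral_liminf_le fun n => by fun_prop
    _ ≤ _ := by
        refine liminf_le_of_le (by isBoundedDefault) fun b hb => ?_
        obtain ⟨n, hn⟩ := hb.exists
        refine hn.trans ?_
        rw [lintegral_pushPrimitive_add_sub measurable_id hf (Nat.cast_nonneg n),
          ← lintegral_const_mul' _ _ (by norm_num)]
        refine lintegral_mono fun k => ?_
        rw [mul_left_comm]
        refine mul_le_mul_right ?_ _
        rw [show (4 : ℝ≥0∞) = ENNReal.ofReal 4 by simp, ← ENNReal.ofReal_mul (by norm_num)]
        apply ENNReal.ofReal_le_ofReal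
        rw [mul_one_div]
        gcongr
        exact norm_exp_I_mul_sub_one_sq_le _

theorem lintegral_Fk_sq_div_le {X φ : ℝ → ℝ} (hder : ∀ y, HasDerivAt X (φ y) y)
    (hφ : ∀ y, 0 < φ y) (hrange : range X = Iio 0) (hloc : ∀ y, φ y ≤ -X y)
    (hgeo : ∀ y y', y < y' → φ y * φ y' * (y' - y) ^ 2 ≤ (X y' - X y) ^ 2)
    {f : ℝ → ℂ} (hf : Integrable f) (hf0 : ∫ y, f y = 0) :
    ∫⁻ k, ‖Fk X f k‖ₑ ^ 2 * ENNReal.ofReal (1 / |k|) ≤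
      (∫⁻ p, ‖ft f p‖ₑ ^ 2 * ENNReal.ofReal (1 / |p|)) +
        gagliardoConst⁻¹ * 4 * ∫⁻ p, ‖ft f p‖ₑ ^ 2 * ENNReal.ofReal (1 / p ^ 2) := by
  have hX : Measurable X := (strictMono_of_hasDerivAt_pos hder hφ).monotone.measurable
  have h := (lintegral_gagliardo_comp_le hder hφ hrange hloc hgeo hf hf0).trans
    (add_le_add le_rfl (lintegral_pushPrimitive_sq_le hf hf0))
  rw [← lintegral_gagliardo_swap (measurable_pushPrimitive hX hf),
    ← lintegral_gagliardo_swap (measurable_pushPrimitive measurable_id hf),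
    lintegral_gagliardo_eq hX hf, lintegral_gagliardo_eq measurable_id hf] at h
  have h' := mul_le_mul_right h gagliardoConst⁻¹
  rw [mul_add, ← mul_assoc, ← mul_assoc, ← mul_assoc,
    ENNReal.inv_mul_cancel gagliardoConst_ne_zero gagliardoConst_ne_top, one_mul, one_mul] at h'
  exact h'

theorem mul_mul_sq_le_of_midpoint {X φ : ℝ → ℝ} (hder : ∀ y, HasDerivAt X (φ y) y)
    (hφ : ∀ y, 0 < φ y)
    (hconc : ∀ m s w, 0 ≤ s → s ≤ w → φ (m + w) * φ (m - w) ≤ φ (m + s) * φ (m - s))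
    {y y' : ℝ} (hy : y < y') : φ y * φ y' * (y' - y) ^ 2 ≤ (X y' - X y) ^ 2 := by
  set m := (y + y') / 2 with hm
  set w := (y' - y) / 2 with hw
  have hw0 : 0 ≤ w := by linarith
  set q := √(φ (m + w) * φ (m - w)) with hq
  have hG : ∀ s, HasDerivAt (fun s => X (m + s) - X (m - s) - 2 * q * s)
      (φ (m + s) + φ (m - s) - 2 * q) s := by
    intro s
    have h1 := (hder (m + s)).comp_const_add m s
    have h2 := (hder (m - s)).comp_const_sub m s
    exact ((h1.sub h2).sub ((hasDerivAt_id s).const_mul (2 * q))).congr_deriv (by ring)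
  have hmono : MonotoneOn (fun s => X (m + s) - X (m - s) - 2 * q * s) (Icc 0 w) := by
    apply monotoneOn_of_deriv_nonneg (convex_Icc 0 w)
    · exact fun s _ => (hG s).continuousAt.continuousWithinAt
    · exact fun s _ => (hG s).differentiableAt.differentiableWithinAt
    · intro s hs
      rw [interior_Icc] at hs
      rw [(hG s).deriv]
      have h1 := hconc m s w hs.1.le hs.2.le
      have ha := hφ (m + s)
      have hb := hφ (m - s)
      have h2 : q ≤ (φ (m + s) + φ (m - s)) / 2 := by
        rw [hq, Real.sqrt_le_left (by positivity)]
        nlinarith [sq_nonneg (φ (m + s) - φ (m - s))]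
      linarith
  have h := hmono (left_mem_Icc.mpr hw0) (right_mem_Icc.mpr hw0) hw0
  have e1 : m + w = y' := by rw [hm, hw]; ring
  have e2 : m - w = y := by rw [hm, hw]; ring
  simp only [add_zero, sub_zero, sub_self, mul_zero, e1, e2] at h
  have hq2 : q ^ 2 = φ y * φ y' := by
    rw [hq, e1, e2, Real.sq_sqrt (mul_pos (hφ _) (hφ _)).le, mul_comm]
  have h0 : 0 ≤ q := Real.sqrt_nonneg _
  rw [← hq2, ← mul_pow]
  apply pow_le_pow_left₀ (mul_nonneg h0 (by linarith))
  have : y' - y = 2 * w := by rw [hw]; ring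
  rw [this]
  linarith

theorem hasDerivAt_exp_neg (y : ℝ) : HasDerivAt (fun y => Real.exp (-y)) (-Real.exp (-y)) y := by
  simpa using (hasDerivAt_neg y).exp

theorem lintegral_Fk_xR_le {f : ℝ → ℂ} (hf : Integrable f) (hf0 : ∫ y, f y = 0) :
    ∫⁻ k, ‖Fk xR f k‖ₑ ^ 2 * ENNReal.ofReal (1 / |k|) ≤
      (∫⁻ p, ‖ft f p‖ₑ ^ 2 * ENNReal.ofReal (1 / |p|)) +
        gagliardoConst⁻¹ * 4 * ∫⁻ p, ‖ft f p‖ₑ ^ 2 * ENNReal.ofReal (1 / p ^ 2) := by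
  have hder : ∀ y, HasDerivAt xR (Real.exp (-y)) y := fun y => by
    have h := (hasDerivAt_exp_neg y).neg
    rwa [neg_neg] at h
  have hpos : ∀ y : ℝ, 0 < Real.exp (-y) := fun y => Real.exp_pos _
  refine lintegral_Fk_sq_div_le hder hpos ?_ ?_ ?_ hf hf0
  · ext x
    constructor
    · rintro ⟨y, rfl⟩
      simpa [xR] using Real.exp_pos (-y)
    · intro hx
      refine ⟨-Real.log (-x), ?_⟩
      rw [xR, neg_neg, Real.exp_log (by simpa using hx), neg_neg]
  · simp [xR]
  · refine fun y y' hy => mul_mul_sq_le_of_midpoint hder hpos (fun m s w _ _ => ?_) hy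
    rw [← Real.exp_add, ← Real.exp_add]
    apply le_of_eq
    congr 1
    ring

theorem lintegral_Fk_xC_le {f : ℝ → ℂ} (hf : Integrable f) (hf0 : ∫ y, f y = 0) :
    ∫⁻ k, ‖Fk xC f k‖ₑ ^ 2 * ENNReal.ofReal (1 / |k|) ≤
      (∫⁻ p, ‖ft f p‖ₑ ^ 2 * ENNReal.ofReal (1 / |p|)) +
        gagliardoConst⁻¹ * 4 * ∫⁻ p, ‖ft f p‖ₑ ^ 2 * ENNReal.ofReal (1 / p ^ 2) := by
  have hpos' : ∀ y : ℝ, 0 < 1 + Real.exp (-y) := fun y => by positivity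
  have hder : ∀ y, HasDerivAt xC (Real.exp (-y) / (1 + Real.exp (-y))) y := fun y => by
    have := (((hasDerivAt_exp_neg y).const_add 1).log (hpos' y).ne').neg
    rwa [neg_div, neg_neg] at this
  have hpos : ∀ y : ℝ, 0 < Real.exp (-y) / (1 + Real.exp (-y)) := fun y => by positivity
  refine lintegral_Fk_sq_div_le hder hpos ?_ ?_ ?_ hf hf0
  · ext x
    constructor
    · rintro ⟨y, rfl⟩
      have := Real.exp_pos (-y)
      simpa [xC] using Real.log_pos (by linarith : 1 < 1 + Real.exp (-y))
    · intro hx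
      have : 1 < Real.exp (-x) := Real.one_lt_exp_iff.mpr (by simpa using hx)
      refine ⟨-Real.log (Real.exp (-x) - 1), ?_⟩
      rw [xC, neg_neg, Real.exp_log (by linarith), add_sub_cancel, Real.log_exp, neg_neg]
  · intro y
    have h := Real.one_sub_inv_le_log_of_pos (hpos' y)
    rw [xC, neg_neg]
    refine le_trans (le_of_eq ?_) h
    have := (hpos' y).ne'
    field_simp
    ring
  · refine fun y y' hy => mul_mul_sq_le_of_midpoint hder hpos (fun m s w hs hsw => ?_) hy
    have e : ∀ r : ℝ, Real.exp (-(m + r)) / (1 + Real.exp (-(m + r))) *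
        (Real.exp (-(m - r)) / (1 + Real.exp (-(m - r)))) =
        Real.exp (-m) ^ 2 / (1 + Real.exp (-m) ^ 2 + 2 * Real.exp (-m) * Real.cosh r) := by
      intro r
      have h1 : Real.exp (-(m + r)) = Real.exp (-m) * Real.exp (-r) := by
        rw [← Real.exp_add]; ring_nf
      have h2 : Real.exp (-(m - r)) = Real.exp (-m) * Real.exp r := by
        rw [← Real.exp_add]; ring_nf
      have h3 : Real.exp r * Real.exp (-r) = 1 := by rw [← Real.exp_add]; simp
      rw [div_mul_div_comm, h1, h2, Real.cosh_eq]
      congr 1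
      · linear_combination Real.exp (-m) ^ 2 * h3
      · linear_combination Real.exp (-m) ^ 2 * h3
    have hcosh : Real.cosh s ≤ Real.cosh w :=
      Real.cosh_le_cosh.mpr (by rwa [abs_of_nonneg hs, abs_of_nonneg (hs.trans hsw)])
    have := Real.cosh_pos s
    rw [e, e]
    gcongr

theorem integral_eq_zero_of_ft_eq_zero {f : ℝ → ℂ} (hf : Integrable f)
    (hf0 : ∀ᵐ p : ℝ, p ≤ 0 → ft f p = 0) : ∫ y, f y = 0 := by
  have hc : Continuous (ft f) := continuous_Fk measurable_id hf
  have h0 : ft f 0 = 0 := by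
    by_contra h
    obtain ⟨ε, hε, hb⟩ := Metric.eventually_nhds_iff.mp (hc.continuousAt.eventually_ne h)
    have hnull : volume (Ioo (-ε) 0) = 0 := by
      refine measure_mono_null (fun p hp => ?_) hf0
      simp only [mem_compl_iff, mem_ofPred_eq]
      intro hz
      exact hb (by rw [Real.dist_eq, sub_zero, abs_of_neg hp.2]; linarith [hp.1]) (hz hp.2.le)
    simp [hε.not_ge] at hnull
  have hpi : (Real.sqrt (2 * Real.pi) : ℂ) ≠ 0 := by
    rw [Complex.ofReal_ne_zero]
    positivity
  rw [ft] at h0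
  simpa using (mul_eq_zero.mp h0).resolve_left (inv_ne_zero hpi)

theorem enorm_setIntegral_sq_le {u v w : ℝ → ℂ} (hu : Measurable u) (hv : Measurable v)
    (hw : ∀ k, 0 < k → ‖w k‖ = ‖u k‖ * ‖v k‖ / (2 * k))
    (hu1 : ∫⁻ k in Ioi (0 : ℝ), ENNReal.ofReal (‖u k‖ ^ 2 / (2 * k)) = 1) :
    ENNReal.ofReal (‖∫ k in Ioi (0 : ℝ), w k‖ ^ 2) ≤
      ∫⁻ k in Ioi (0 : ℝ), ENNReal.ofReal (‖v k‖ ^ 2 / (2 * k)) := by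
  have hsq : ∀ z : ℝ → ℂ, ∫⁻ k in Ioi (0 : ℝ), ENNReal.ofReal (‖z k‖ / √(2 * k)) ^ (2 : ℝ) =
      ∫⁻ k in Ioi (0 : ℝ), ENNReal.ofReal (‖z k‖ ^ 2 / (2 * k)) := by
    intro z
    refine setLIntegral_congr_fun measurableSet_Ioi fun k hk => ?_
    have hk0 : (0 : ℝ) < k := hk
    rw [ENNReal.rpow_two, ← ENNReal.ofReal_pow (by positivity), div_pow,
      Real.sq_sqrt (by positivity)]
  have hCS := ENNReal.lintegral_mul_le_Lp_mul_Lq (volume.restrict (Ioi (0 : ℝ)))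
    Real.HolderConjugate.two_two
    (f := fun k => ENNReal.ofReal (‖u k‖ / √(2 * k)))
    (g := fun k => ENNReal.ofReal (‖v k‖ / √(2 * k)))
    (by fun_prop) (by fun_prop)
  rw [hsq, hsq, hu1, ENNReal.one_rpow, one_mul] at hCS
  have hle : ‖∫ k in Ioi (0 : ℝ), w k‖ₑ ≤
      (∫⁻ k in Ioi (0 : ℝ), ENNReal.ofReal (‖v k‖ ^ 2 / (2 * k))) ^ (1 / 2 : ℝ) := by
    refine (enorm_integral_le_lintegral_enorm _).trans (le_trans (le_of_eq ?_) hCS)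
    refine setLIntegral_congr_fun measurableSet_Ioi fun k hk => ?_
    have hk0 : (0 : ℝ) < k := hk
    simp only [Pi.mul_apply]
    rw [← ofReal_norm, hw k hk0, ← ENNReal.ofReal_mul (by positivity), div_mul_div_comm,
      Real.mul_self_sqrt (by positivity)]
  rw [ENNReal.ofReal_pow (norm_nonneg _), ofReal_norm]
  refine (pow_le_pow_left₀ zero_le hle 2).trans (le_of_eq ?_)
  rw [← ENNReal.rpow_two, ← ENNReal.rpow_mul]
  norm_num

theorem lintegral_Ioi_le_lintegral (F : ℝ → ℂ) :
    ∫⁻ k in Ioi (0 : ℝ), ENNReal.ofReal (‖F k‖ ^ 2 / (2 * k)) ≤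
      ∫⁻ k, ‖F k‖ₑ ^ 2 * ENNReal.ofReal (1 / |k|) := by
  refine le_trans (setLIntegral_mono' measurableSet_Ioi fun k hk => ?_)
    (setLIntegral_le_lintegral (Ioi 0) _)
  have hk0 : (0 : ℝ) < k := hk
  rw [← ofReal_norm, ← ENNReal.ofReal_pow (norm_nonneg _), ← ENNReal.ofReal_mul (by positivity),
    abs_of_pos hk0, mul_one_div]
  apply ENNReal.ofReal_le_ofReal
  gcongr
  linarith

theorem lintegral_Ioi_neg_le_lintegral (F : ℝ → ℂ) :
    ∫⁻ k in Ioi (0 : ℝ), ENNReal.ofReal (‖F (-k)‖ ^ 2 / (2 * k)) ≤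
      ∫⁻ k, ‖F k‖ₑ ^ 2 * ENNReal.ofReal (1 / |k|) := by
  refine (lintegral_Ioi_le_lintegral fun k => F (-k)).trans (le_of_eq ?_)
  have h := lintegral_comp_mul_left (fun k => ‖F k‖ₑ ^ 2 * ENNReal.ofReal (1 / |k|))
    (by norm_num : (-1 : ℝ) ≠ 0)
  simpa using h

theorem Ng_le {x : ℝ → ℝ} (hx : Measurable x) {f g : ℝ → ℂ} (hf : Integrable f)
    (hg : Integrable g)
    (hg1 : ∫⁻ k in Ioi (0 : ℝ), ENNReal.ofReal (‖ft g k‖ ^ 2 / (2 * k)) = 1) :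
    Ng x g f ≤ 3 * ∫⁻ k, ‖Fk x f k‖ₑ ^ 2 * ENNReal.ofReal (1 / |k|) := by
  have hF : Measurable (Fk x f) := (continuous_Fk hx hf).measurable
  have hG : Measurable (ft g) := (continuous_Fk measurable_id hg).measurable
  have hA := (enorm_setIntegral_sq_le hG hF
    (w := fun k => (starRingEnd ℂ) (ft g k) * Fk x f k / (2 * (k : ℂ)))
    (fun k hk => by simp [abs_of_pos hk]) hg1).trans (lintegral_Ioi_le_lintegral _)
  have hB := (enorm_setIntegral_sq_le hG (hF.comp measurable_neg)
    (w := fun k => ft g k * Fk x f (-k) / (2 * (k : ℂ)))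
    (fun k hk => by simp [abs_of_pos hk]) hg1).trans (lintegral_Ioi_neg_le_lintegral _)
  rw [Ng, Aip, Bip, show (3 : ℝ≥0∞) = 1 + 1 + 1 by norm_num, add_mul, add_mul, one_mul]
  exact add_le_add (add_le_add (lintegral_Ioi_neg_le_lintegral _) hA) hB

theorem lintegral_weight_le {F : ℝ → ℂ} (hF : ∀ᵐ p : ℝ, p ≤ 0 → F p = 0) {W V : ℝ → ℝ} {a : ℝ}
    (ha : 0 ≤ a) (hW : ∀ p, 0 < p → W p ≤ a * V p) :
    ∫⁻ p, ‖F p‖ₑ ^ 2 * ENNReal.ofReal (W p) ≤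
      ENNReal.ofReal a * ∫⁻ p in Ioi (0 : ℝ), ENNReal.ofReal (‖F p‖ ^ 2 * V p) := by
  rw [← lintegral_const_mul' _ _ ENNReal.ofReal_ne_top, ← lintegral_indicator measurableSet_Ioi]
  apply lintegral_mono_ae
  filter_upwards [hF] with p hp
  by_cases h : 0 < p
  · rw [indicator_of_mem (show p ∈ Ioi 0 from h), ← ofReal_norm,
      ← ENNReal.ofReal_pow (norm_nonneg _), ← ENNReal.ofReal_mul (by positivity),
      ← ENNReal.ofReal_mul ha]
    apply ENNReal.ofReal_le_ofReal
    rw [mul_left_comm]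
    exact mul_le_mul_of_nonneg_left (hW p h) (by positivity)
  · simp [hp (not_lt.mp h)]

theorem one_sub_exp_pos {p : ℝ} (hp : 0 < p) : 0 < 1 - Real.exp (-(2 * Real.pi) * p) := by
  have : Real.exp (-(2 * Real.pi) * p) < 1 := by
    rw [Real.exp_lt_one_iff]
    nlinarith [Real.pi_pos]
  linarith

/-- For `x = x_R` or `x = x_C`, there exists a constant `C > 0`,
independent of `f` and `g`, such that for every normalized outgoing wave function `f`
and normalized incoming wave function `g`,
`N̄_g[f] ≤ C ∫_0^∞ |f̂(p)|²/(2p(1-e^{-2πp})) dp` in `[0,∞]`. -/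
theorem stmt_9 (x : ℝ → ℝ) (hx : x = xR ∨ x = xC) :
    ∃ C : ℝ, 0 < C ∧ ∀ f g : ℝ → ℂ,
      MeasureTheory.Integrable f →
      (∀ᵐ p : ℝ, p ≤ 0 → ft f p = 0) →
      (∫⁻ p in Set.Ioi (0:ℝ), ENNReal.ofReal (‖ft f p‖ ^ 2 / (2 * p))) = 1 →
      MeasureTheory.Integrable g →
      (∀ᵐ k : ℝ, k ≤ 0 → ft g k = 0) →
      (∫⁻ k in Set.Ioi (0:ℝ), ENNReal.ofReal (‖ft g k‖ ^ 2 / (2 * k))) = 1 →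
      Ng x g f ≤ ENNReal.ofReal C *
        ∫⁻ p in Set.Ioi (0:ℝ), ENNReal.ofReal
          (‖ft f p‖ ^ 2 / (2 * p * (1 - Real.exp (-(2 * Real.pi) * p)))) := by
  have hx' : Measurable x := by
    rcases hx with rfl | rfl
    · unfold xR; fun_prop
    · unfold xC; fun_prop
  have hcinv : gagliardoConst⁻¹ ≠ ⊤ := ENNReal.inv_ne_top.mpr gagliardoConst_ne_zero
  set K : ℝ := gagliardoConst⁻¹.toReal with hK
  have hK0 : 0 ≤ K := ENNReal.toReal_nonneg
  refine ⟨3 * (2 + K * 4 * (4 * Real.pi)), by positivity, ?_⟩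
  intro f g hf hf0 _ hg _ hg1
  have hfi := integral_eq_zero_of_ft_eq_zero hf hf0
  have h1 := lintegral_weight_le hf0 (W := fun p => 1 / |p|)
    (V := fun p => (2 * p * (1 - Real.exp (-(2 * Real.pi) * p)))⁻¹) zero_le_two fun p hp => by
    have h := one_sub_exp_pos hp
    have h' := Real.exp_pos (-(2 * Real.pi) * p)
    rw [abs_of_pos hp, ← div_eq_mul_inv, div_le_div_iff₀ hp (by positivity)]
    nlinarith
  have h2 := lintegral_weight_le hf0 (W := fun p => 1 / p ^ 2)
    (V := fun p => (2 * p * (1 - Real.exp (-(2 * Real.pi) * p)))⁻¹)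
    (by positivity : 0 ≤ 4 * Real.pi) fun p hp => by
    have h := one_sub_exp_pos hp
    have h' := Real.add_one_le_exp (-(2 * Real.pi) * p)
    rw [← div_eq_mul_inv, div_le_div_iff₀ (by positivity) (by positivity)]
    nlinarith
  have h3 : ∫⁻ k, ‖Fk x f k‖ₑ ^ 2 * ENNReal.ofReal (1 / |k|) ≤
      (∫⁻ p, ‖ft f p‖ₑ ^ 2 * ENNReal.ofReal (1 / |p|)) +
        gagliardoConst⁻¹ * 4 * ∫⁻ p, ‖ft f p‖ₑ ^ 2 * ENNReal.ofReal (1 / p ^ 2) := by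
    rcases hx with rfl | rfl
    · exact lintegral_Fk_xR_le hf hfi
    · exact lintegral_Fk_xC_le hf hfi
  refine (Ng_le hx' hf hg hg1).trans ?_
  simp_rw [div_eq_mul_inv]
  rw [ENNReal.ofReal_mul (by norm_num), ENNReal.ofReal_add (by norm_num) (by positivity),
    ENNReal.ofReal_mul (by positivity), ENNReal.ofReal_mul hK0, hK, ENNReal.ofReal_toReal hcinv,
    mul_assoc, ENNReal.ofReal_ofNat, ENNReal.ofReal_ofNat, add_mul, mul_assoc]
  refine mul_le_mul_right ?_ _
  simp_rw [one_div, ENNReal.ofReal_ofNat] at h1 h2 h3 ⊢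
  simp_rw [one_mul]
  exact h3.trans (add_le_add h1 (mul_le_mul_right h2 _))
end

section
/- Let x be either the relativistic map x_R(y) = −e^{−y} or the CGHS map x_C(y) = −log(1 + e^{−y}). Let f be a normalized outgoing wave function and g a normalized incoming wave function. Then |⟨g̃, Af̃⟩|² + |⟨g̃*, Bf̃⟩|² ≤ (1/π) (∫_{−∞}^0 |g(x)| dx)² (∫_0^∞ |f̂(p)|/(2p) dp)²; that is, the number of extra particles created by the one-particle state satisfies |N̄_g[f] − N̄_o[f]| ≤ (1/π) ‖g‖²_{L¹((−∞,0))} (∫_0^∞ |f̂(p)|/(2p) dp)². -/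
open MeasureTheory Set Filter
open scoped ENNReal

open scoped Topology

/-- A continuous integrable approximation of the Heaviside function, which it tends to
as `ε → 0⁺`. -/
noncomputable def stepKernel (ε s : ℝ) : ℝ :=
  (Real.exp (-(ε * max s 0)) - Real.exp (-(ε⁻¹ * max s 0))) / (1 - ε ^ 2)

/-- The Fourier transform of `stepKernel ε`, up to normalization. -/
noncomputable def stepMultiplier (ε k : ℝ) : ℂ :=
  ((ε + Complex.I * k) * (1 + Complex.I * ε * k))⁻¹

theorem continuous_stepKernel (ε : ℝ) : Continuous (stepKernel ε) := by
  unfold stepKernel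
  fun_prop

theorem abs_stepKernel_le {ε : ℝ} (h0 : 0 < ε) (h1 : ε ≤ 1 / 2) (s : ℝ) :
    |stepKernel ε s| ≤ 2 := by
  have hm : 0 ≤ max s 0 := le_max_right _ _
  have hd : 1 / 2 ≤ 1 - ε ^ 2 := by nlinarith
  have e1 : Real.exp (-(ε * max s 0)) ≤ 1 := by
    rw [Real.exp_le_one_iff]; have := mul_nonneg h0.le hm; linarith
  have e2 : Real.exp (-(ε⁻¹ * max s 0)) ≤ 1 := by
    rw [Real.exp_le_one_iff]; have := mul_nonneg (inv_pos.2 h0).le hm; linarith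
  have e3 := Real.exp_pos (-(ε * max s 0))
  have e4 := Real.exp_pos (-(ε⁻¹ * max s 0))
  rw [stepKernel, abs_div, abs_of_pos (by linarith : (0 : ℝ) < 1 - ε ^ 2),
    div_le_iff₀ (by linarith)]
  refine (abs_le.2 ⟨?_, ?_⟩ : _ ≤ (1 : ℝ)).trans (by linarith) <;> linarith

theorem tendsto_stepKernel (s : ℝ) :
    Tendsto (fun ε => stepKernel ε s) (𝓝[>] 0) (𝓝 ((Ioi (0 : ℝ)).indicator 1 s)) := by
  by_cases hs : 0 < s
  · have h1 : Tendsto (fun ε : ℝ => Real.exp (-(ε * s))) (𝓝[>] 0) (𝓝 1) := by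
      have : Continuous fun ε : ℝ => Real.exp (-(ε * s)) := by fun_prop
      have := this.tendsto 0
      simp only [zero_mul, neg_zero, Real.exp_zero] at this
      exact this.mono_left nhdsWithin_le_nhds
    have h2 : Tendsto (fun ε : ℝ => Real.exp (-(ε⁻¹ * s))) (𝓝[>] 0) (𝓝 0) :=
      Real.tendsto_exp_neg_atTop_nhds_zero.comp (tendsto_inv_nhdsGT_zero.atTop_mul_const hs)
    have h3 : Tendsto (fun ε : ℝ => 1 - ε ^ 2) (𝓝[>] 0) (𝓝 1) := by
      have : Continuous fun ε : ℝ => 1 - ε ^ 2 := by fun_prop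
      have := this.tendsto 0
      norm_num at this
      exact this.mono_left nhdsWithin_le_nhds
    have := (h1.sub h2).div h3 one_ne_zero
    simpa [stepKernel, hs, max_eq_left hs.le, Pi.div_def] using this
  · have hm : max s 0 = 0 := max_eq_right (not_lt.1 hs)
    simp [stepKernel, hm, hs]

theorem integral_stepKernel_mul_exp {ε : ℝ} (h0 : 0 < ε) (h1 : ε ≤ 1 / 2) (k : ℝ) :
    Integrable (fun s => (stepKernel ε s : ℂ) * Complex.exp (-Complex.I * k * s)) ∧
    ∫ s, (stepKernel ε s : ℂ) * Complex.exp (-Complex.I * k * s) = stepMultiplier ε k := by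
  set a : ℂ := -(ε + Complex.I * k) with ha
  set b : ℂ := -((ε : ℂ)⁻¹ + Complex.I * k) with hb
  have har : a.re < 0 := by simp [ha, h0]
  have hbr : b.re < 0 := by
    rw [hb, ← Complex.ofReal_inv]; simp [h0]
  have hfun : (fun s => (stepKernel ε s : ℂ) * Complex.exp (-Complex.I * k * s)) =
      (Ioi (0 : ℝ)).indicator
        (fun s : ℝ => (Complex.exp (a * s) - Complex.exp (b * s)) / (1 - ε ^ 2)) := by
    funext s
    by_cases hs : 0 < s
    · rw [indicator_of_mem (mem_Ioi.2 hs), stepKernel, max_eq_left hs.le]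
      push_cast
      rw [div_mul_eq_mul_div, sub_mul, ← Complex.exp_add, ← Complex.exp_add]
      congr 3 <;> simp only [ha, hb] <;> ring
    · rw [indicator_of_notMem (by simpa using hs), stepKernel,
        max_eq_right (not_lt.1 hs)]
      simp
  have ia := integrableOn_exp_mul_complex_Ioi har 0
  have ib := integrableOn_exp_mul_complex_Ioi hbr 0
  rw [hfun]
  refine ⟨(integrable_indicator_iff measurableSet_Ioi).2 ((ia.sub ib).div_const _), ?_⟩
  rw [integral_indicator measurableSet_Ioi, integral_div, integral_sub ia ib,
    integral_exp_mul_complex_Ioi har, integral_exp_mul_complex_Ioi hbr]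
  have ha0 : a ≠ 0 := fun h => by simp [h] at har
  have hb0 : b ≠ 0 := fun h => by simp [h] at hbr
  have hε : (ε : ℂ) ≠ 0 := by exact_mod_cast h0.ne'
  have hd : (1 - (ε : ℂ) ^ 2) ≠ 0 := by
    have : (1 - ε ^ 2 : ℝ) ≠ 0 := by nlinarith
    exact_mod_cast this
  have hab : stepMultiplier ε k = (ε * (a * b))⁻¹ := by
    rw [stepMultiplier, ha, hb]
    congr 1
    field_simp
  rw [hab]
  simp only [Complex.ofReal_zero, mul_zero, Complex.exp_zero]
  have hba : a - b = (1 - ε ^ 2) / ε := by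
    rw [ha, hb]; field_simp; ring
  have : -1 / a - -1 / b = (a - b) / (a * b) := by field_simp; ring
  rw [this, hba]
  field_simp

theorem integrable_stepKernel {ε : ℝ} (h0 : 0 < ε) (h1 : ε ≤ 1 / 2) :
    Integrable (fun s => (stepKernel ε s : ℂ)) := by
  simpa using (integral_stepKernel_mul_exp h0 h1 0).1

theorem norm_stepMultiplier_le (ε : ℝ) {k : ℝ} (hk : k ≠ 0) :
    ‖stepMultiplier ε k‖ ≤ |k|⁻¹ := by
  have hk' : 0 < |k| := abs_pos.2 hk
  rw [stepMultiplier, norm_inv]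
  have e1 : |k| ≤ ‖(ε + Complex.I * k : ℂ)‖ := by
    simpa using Complex.abs_im_le_norm (ε + Complex.I * k : ℂ)
  have e2 : 1 ≤ ‖(1 + Complex.I * ε * k : ℂ)‖ := by
    simpa using Complex.abs_re_le_norm (1 + Complex.I * ε * k : ℂ)
  gcongr
  rw [norm_mul]
  nlinarith [abs_nonneg k]

theorem continuous_stepMultiplier {ε : ℝ} (h0 : 0 < ε) : Continuous (stepMultiplier ε) := by
  unfold stepMultiplier
  refine Continuous.inv₀ (by fun_prop) fun k => mul_ne_zero (fun h => ?_) fun h => ?_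
  · simpa [h0.ne'] using congrArg Complex.re h
  · simpa using congrArg Complex.re h

theorem integrable_stepMultiplier {ε : ℝ} (h0 : 0 < ε) (h1 : ε ≤ 1 / 2) :
    Integrable (stepMultiplier ε) := by
  refine (integrable_inv_one_add_sq.const_mul (ε ^ 2)⁻¹).mono'
    (continuous_stepMultiplier h0).aestronglyMeasurable (ae_of_all _ fun k => ?_)
  have key : (ε ^ 2 * (1 + k ^ 2)) ^ 2 ≤
      ‖((ε + Complex.I * k) * (1 + Complex.I * ε * k) : ℂ)‖ ^ 2 := by
    rw [norm_mul, mul_pow ‖_‖, ← Complex.normSq_eq_norm_sq, ← Complex.normSq_eq_norm_sq]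
    simp only [Complex.normSq_apply]
    simp
    have hε : ε ^ 2 ≤ 1 := by nlinarith
    have hk := sq_nonneg k
    have e1 : ε ^ 2 * (1 + k ^ 2) ≤ ε * ε + k * k := by nlinarith
    have e2 : ε ^ 2 * (1 + k ^ 2) ≤ 1 + ε * k * (ε * k) := by nlinarith
    rw [sq (ε ^ 2 * (1 + k ^ 2))]
    exact mul_le_mul e1 e2 (by positivity) (by nlinarith)
  rw [stepMultiplier, norm_inv, ← mul_inv]
  gcongr
  exact le_of_sq_le_sq key (norm_nonneg _)

theorem tendsto_stepMultiplier {k : ℝ} (hk : k ≠ 0) :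
    Tendsto (fun ε => stepMultiplier ε k) (𝓝[>] 0) (𝓝 (Complex.I * k)⁻¹) := by
  have hc : Continuous fun ε : ℝ => ((ε + Complex.I * k) * (1 + Complex.I * ε * k) : ℂ) := by
    fun_prop
  have := hc.tendsto 0
  simp only [Complex.ofReal_zero, zero_add, mul_zero, zero_mul, add_zero, mul_one] at this
  exact (this.mono_left nhdsWithin_le_nhds).inv₀ (by simp [hk])

theorem stepKernel_eq_integral {ε : ℝ} (h0 : 0 < ε) (h1 : ε ≤ 1 / 2) (s : ℝ) :
    (stepKernel ε s : ℂ) =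
      (2 * Real.pi : ℂ)⁻¹ * ∫ k, stepMultiplier ε k * Complex.exp (Complex.I * k * s) := by
  have hF : FourierTransform.fourier (fun s => (stepKernel ε s : ℂ)) =
      fun w => stepMultiplier ε (2 * Real.pi * w) := by
    funext w
    rw [Real.fourier_real_eq_integral_exp_smul, ← (integral_stepKernel_mul_exp h0 h1 _).2]
    congr 1; funext v
    rw [smul_eq_mul, mul_comm]
    congr 2; push_cast; ring
  have hint : Integrable (fun w => stepMultiplier ε (2 * Real.pi * w)) :=
    (integrable_stepMultiplier h0 h1).comp_mul_left' (by positivity)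
  have hinv := (integrable_stepKernel h0 h1).fourierInv_fourier_eq (hF ▸ hint)
    (v := s) (Complex.continuous_ofReal.comp (continuous_stepKernel ε)).continuousAt
  rw [hF, Real.fourierInv_eq_fourier_neg, Real.fourier_real_eq_integral_exp_smul] at hinv
  rw [← hinv]
  have := Measure.integral_comp_mul_left
    (fun k : ℝ => stepMultiplier ε k * Complex.exp (Complex.I * k * s)) (2 * Real.pi)
  rw [abs_of_pos (by positivity)] at this
  rw [Complex.real_smul] at this
  push_cast at this
  rw [← this]
  congr 1; funext v
  rw [smul_eq_mul, mul_comm]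
  congr 2; push_cast; ring

theorem norm_exp_I_mul_mul (a b : ℝ) : ‖Complex.exp (Complex.I * a * b)‖ = 1 := by
  rw [show Complex.I * a * b = ((a * b : ℝ) : ℂ) * Complex.I by push_cast; ring]
  exact Complex.norm_exp_ofReal_mul_I _

theorem norm_exp_neg_I_mul_mul (a b : ℝ) : ‖Complex.exp (-Complex.I * a * b)‖ = 1 := by
  simpa using norm_exp_I_mul_mul (-a) b

/-- The convolution of `h` with `stepKernel ε`, evaluated on the Fourier side. -/
theorem integral_mul_stepKernel {ε : ℝ} (h0 : 0 < ε) (h1 : ε ≤ 1 / 2) {h : ℝ → ℂ}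
    (hh : Integrable h) (s : ℝ) :
    ∫ y, h y * stepKernel ε (s - y) =
      (Real.sqrt (2 * Real.pi) : ℂ)⁻¹ *
        ∫ k, ft h k * stepMultiplier ε k * Complex.exp (Complex.I * k * s) := by
  have hint : Integrable (Function.uncurry fun y k : ℝ =>
      h y * (stepMultiplier ε k * Complex.exp (Complex.I * k * (s - y : ℝ)))) := by
    refine ((hh.mul_prod (integrable_stepMultiplier h0 h1)).mul_bdd
      (g := fun z : ℝ × ℝ => Complex.exp (Complex.I * z.2 * (s - z.1 : ℝ))) (c := 1) ?_ ?_).congr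
      (ae_of_all _ fun z => ?_)
    · exact Continuous.aestronglyMeasurable (by fun_prop)
    · exact ae_of_all _ fun z => (norm_exp_I_mul_mul _ _).le
    · simp only [Function.uncurry]; ring
  have hpi : ((Real.sqrt (2 * Real.pi) : ℂ)⁻¹) * (Real.sqrt (2 * Real.pi) : ℂ)⁻¹ =
      (2 * Real.pi : ℂ)⁻¹ := by
    rw [← mul_inv, ← Complex.ofReal_mul, Real.mul_self_sqrt (by positivity)]
    push_cast; rfl
  calc ∫ y, h y * stepKernel ε (s - y)
      = ∫ y, (2 * Real.pi : ℂ)⁻¹ * ∫ k : ℝ,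
          h y * (stepMultiplier ε k * Complex.exp (Complex.I * k * (s - y : ℝ))) := by
        congr 1; funext y
        rw [stepKernel_eq_integral h0 h1, integral_const_mul]
        ring
    _ = (2 * Real.pi : ℂ)⁻¹ * ∫ k : ℝ, ∫ y,
          h y * (stepMultiplier ε k * Complex.exp (Complex.I * k * (s - y : ℝ))) := by
        rw [integral_const_mul, integral_integral_swap hint]
    _ = _ := by
        rw [← hpi, mul_assoc, ← integral_const_mul]
        congr 2; funext k
        rw [ft, mul_assoc, mul_assoc, ← integral_mul_const]
        congr 2; funext y
        rw [show Complex.I * k * (s - y : ℝ) =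
          -Complex.I * k * y + Complex.I * k * s by push_cast; ring, Complex.exp_add]
        ring

theorem eventually_nhdsGT_zero_le_half : ∀ᶠ ε : ℝ in 𝓝[>] 0, 0 < ε ∧ ε ≤ 1 / 2 :=
  (Ioc_mem_nhdsGT (by norm_num : (0 : ℝ) < 1 / 2))

theorem tendsto_integral_mul_stepKernel {h : ℝ → ℂ} (hh : Integrable h) (s : ℝ) :
    Tendsto (fun ε => ∫ y, h y * stepKernel ε (s - y)) (𝓝[>] 0) (𝓝 (∫ y in Iio s, h y)) := by
  rw [← integral_indicator measurableSet_Iio]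
  refine tendsto_integral_filter_of_dominated_convergence (fun y => ‖h y‖ * 2) ?_ ?_
    (hh.norm.mul_const 2) (ae_of_all _ fun y => ?_)
  · refine Eventually.of_forall fun ε => hh.1.mul ?_
    exact (Complex.continuous_ofReal.comp ((continuous_stepKernel ε).comp
      (continuous_const.sub continuous_id))).aestronglyMeasurable
  · filter_upwards [eventually_nhdsGT_zero_le_half] with ε hε
    refine ae_of_all _ fun y => ?_
    rw [norm_mul, Complex.norm_real]
    gcongr
    exact abs_stepKernel_le hε.1 hε.2 _
  · have h1 := (Complex.continuous_ofReal.tendsto _).comp (tendsto_stepKernel (s - y))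
    have h2 : (Iio s).indicator h y = h y * ((Ioi (0 : ℝ)).indicator 1 (s - y) : ℝ) := by
      by_cases hy : y < s <;> simp [hy]
    rw [h2]
    exact h1.const_mul (h y)

theorem norm_integral_mul_stepKernel_le {ε : ℝ} (h0 : 0 < ε) (h1 : ε ≤ 1 / 2) {h : ℝ → ℂ}
    (hh : Integrable h) (s : ℝ) :
    ‖∫ y, h y * stepKernel ε (s - y)‖ ≤ (∫ y, ‖h y‖) * 2 := by
  rw [← integral_mul_const]
  refine norm_integral_le_of_norm_le (hh.norm.mul_const 2) (ae_of_all _ fun y => ?_)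
  rw [norm_mul, Complex.norm_real]
  gcongr
  exact abs_stepKernel_le h0 h1 _

theorem ae_ne_zero : ∀ᵐ k : ℝ, k ≠ 0 := Measure.ae_ne volume 0

theorem enorm_integral_Iio_le {h : ℝ → ℂ} (hh : Integrable h) (s : ℝ) :
    ‖∫ y in Iio s, h y‖ₑ ≤ ENNReal.ofReal (Real.sqrt (2 * Real.pi))⁻¹ *
      ∫⁻ k, ENNReal.ofReal (‖ft h k‖ / |k|) := by
  refine le_of_tendsto (tendsto_integral_mul_stepKernel hh s).enorm ?_
  filter_upwards [eventually_nhdsGT_zero_le_half] with ε hε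
  rw [integral_mul_stepKernel hε.1 hε.2 hh, enorm_mul]
  gcongr
  · rw [← Complex.ofReal_inv, ← ofReal_norm, Complex.norm_real, Real.norm_of_nonneg]
    positivity
  · refine (enorm_integral_le_lintegral_enorm _).trans (lintegral_mono_ae ?_)
    filter_upwards [ae_ne_zero] with k hk
    rw [← ofReal_norm, norm_mul, norm_mul, norm_exp_I_mul_mul, mul_one, div_eq_mul_inv]
    gcongr
    exact norm_stepMultiplier_le ε hk

theorem ft_comp_neg (f : ℝ → ℂ) (k : ℝ) : ft (fun y => f (-y)) k = ft f (-k) := by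
  rw [ft, ft, ← integral_neg_eq_self]
  simp

/-- The tails of a positive-frequency function are controlled by `∫ |f̂(p)| / (2p) dp`. -/
theorem enorm_integral_Ioi_le {f : ℝ → ℂ} (hf : Integrable f)
    (hfp : ∀ᵐ p : ℝ, p ≤ 0 → ft f p = 0) (a : ℝ) :
    ‖∫ y in Ioi a, f y‖ₑ ≤ ENNReal.ofReal (Real.sqrt (2 * Real.pi))⁻¹ *
      (2 * ∫⁻ p in Ioi (0 : ℝ), ENNReal.ofReal (‖ft f p‖ / (2 * p))) := by
  have h1 := enorm_integral_Iio_le hf.comp_neg (-a)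
  have h2 : ∫ y in Iio (-a), f (-y) = ∫ y in Ioi a, f y := by
    rw [← integral_Iic_eq_integral_Iio, integral_comp_neg_Iic, neg_neg]
  rw [h2] at h1
  refine h1.trans (mul_le_mul_right ?_ _)
  rw [← lintegral_const_mul' _ _ (by simp), ← lintegral_indicator measurableSet_Ioi]
  simp only [ft_comp_neg]
  rw [← lintegral_neg_eq_self]
  refine lintegral_mono_ae ?_
  filter_upwards [hfp] with p hp
  by_cases h : 0 < p
  · simp only [neg_neg, abs_neg, abs_of_pos h, indicator_of_mem (mem_Ioi.2 h)]
    rw [← ENNReal.ofReal_ofNat 2, ← ENNReal.ofReal_mul (by norm_num)]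
    apply ENNReal.ofReal_le_ofReal
    apply le_of_eq
    field_simp
  · simp [hp (not_lt.1 h)]

theorem enorm_integral_mul_integral_Iio_le {x : ℝ → ℝ} (hx : Measurable x)
    (hx0 : ∀ y, x y < 0) (ha : ∀ t < 0, ∃ a, ∀ y, t < x y ↔ a < y) {f g : ℝ → ℂ}
    (hf : Integrable f) (hg : Integrable g) {K : ℝ≥0∞} (hK : ∀ a, ‖∫ y in Ioi a, f y‖ₑ ≤ K) :
    ‖∫ y, f y * ∫ t in Iio (x y), g t‖ₑ ≤ (∫⁻ t in Iio (0 : ℝ), ‖g t‖ₑ) * K := by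
  set S : Set (ℝ × ℝ) := {z | z.2 < x z.1} with hS
  have hSm : MeasurableSet S := measurableSet_lt measurable_snd (hx.comp measurable_fst)
  have hint : Integrable (Function.uncurry fun y t : ℝ =>
      S.indicator (fun z : ℝ × ℝ => f z.1 * g z.2) (y, t)) := (hf.mul_prod hg).indicator hSm
  have h1 : ∫ y, f y * ∫ t in Iio (x y), g t =
      ∫ y, ∫ t, S.indicator (fun z : ℝ × ℝ => f z.1 * g z.2) (y, t) := by
    congr 1; funext y
    rw [← integral_const_mul, ← integral_indicator measurableSet_Iio]
    rfl
  rw [h1, integral_integral_swap hint, ← lintegral_indicator measurableSet_Iio,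
    ← lintegral_mul_const'' _ (hg.1.enorm.indicator measurableSet_Iio)]
  refine (enorm_integral_le_lintegral_enorm _).trans (lintegral_mono fun t => ?_)
  by_cases ht : t < 0
  · obtain ⟨a, ha⟩ := ha t ht
    have : ∀ y, S.indicator (fun z : ℝ × ℝ => f z.1 * g z.2) (y, t) =
        (Ioi a).indicator f y * g t := fun y => by
      by_cases hy : a < y
      · rw [indicator_of_mem (by exact (ha y).2 hy), indicator_of_mem (mem_Ioi.2 hy)]
      · rw [indicator_of_notMem (fun h : (y, t) ∈ S => hy ((ha y).1 h)), indicator_of_notMem (by simpa using hy),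
          zero_mul]
    simp only [this]
    rw [integral_mul_const, integral_indicator measurableSet_Ioi, enorm_mul, mul_comm,
      indicator_of_mem (mem_Iio.2 ht)]
    gcongr
    exact hK a
  · have : ∀ y, S.indicator (fun z : ℝ × ℝ => f z.1 * g z.2) (y, t) = 0 := fun y =>
      indicator_of_notMem (fun h : (y, t) ∈ S => ht (lt_trans h (hx0 y))) _
    simp [this]

theorem continuous_ft {g : ℝ → ℂ} (hg : Integrable g) : Continuous (ft g) := by
  refine continuous_const.mul (continuous_of_dominated (bound := fun y => ‖g y‖) ?_ ?_ hg.norm ?_)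
  · exact fun k => hg.1.mul (Continuous.aestronglyMeasurable (by fun_prop))
  · exact fun k => ae_of_all _ fun y => by rw [norm_mul, norm_exp_neg_I_mul_mul, mul_one]
  · exact ae_of_all _ fun y => by fun_prop

theorem norm_ft_le (g : ℝ → ℂ) (k : ℝ) :
    ‖ft g k‖ ≤ (Real.sqrt (2 * Real.pi))⁻¹ * ∫ y, ‖g y‖ := by
  rw [ft, norm_mul, ← Complex.ofReal_inv, Complex.norm_real, Real.norm_of_nonneg (by positivity)]
  gcongr
  refine (norm_integral_le_integral_norm _).trans_eq ?_
  simp only [norm_mul, norm_exp_neg_I_mul_mul, mul_one]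

/-- Regularized form of the pairing `⟨g̃*, Bf̃⟩`, rewritten in position space. -/
theorem integral_ft_mul_stepMultiplier_mul_Fk {ε : ℝ} (h0 : 0 < ε) (h1 : ε ≤ 1 / 2)
    {x : ℝ → ℝ} (hx : Measurable x) {f g : ℝ → ℂ} (hf : Integrable f) (hg : Integrable g) :
    ∫ k, ft g k * stepMultiplier ε k * Fk x f (-k) =
      ∫ y, f y * ∫ t, g t * stepKernel ε (x y - t) := by
  have hm : Integrable fun k => ft g k * stepMultiplier ε k :=
    (integrable_stepMultiplier h0 h1).bdd_mul (continuous_ft hg).aestronglyMeasurable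
      (ae_of_all _ (norm_ft_le g))
  have hint : Integrable (Function.uncurry fun k y : ℝ =>
      ft g k * stepMultiplier ε k * (f y * Complex.exp (Complex.I * k * x y))) := by
    refine ((hm.mul_prod hf).mul_bdd
      (g := fun z : ℝ × ℝ => Complex.exp (Complex.I * z.1 * x z.2)) (c := 1) ?_ ?_).congr
      (ae_of_all _ fun z => ?_)
    · exact Measurable.aestronglyMeasurable (by fun_prop)
    · exact ae_of_all _ fun z => (norm_exp_I_mul_mul _ _).le
    · simp only [Function.uncurry]; ring
  calc ∫ k, ft g k * stepMultiplier ε k * Fk x f (-k)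
      = ∫ k : ℝ, (Real.sqrt (2 * Real.pi) : ℂ)⁻¹ * ∫ y,
          ft g k * stepMultiplier ε k * (f y * Complex.exp (Complex.I * k * x y)) := by
        congr 1; funext k
        rw [Fk, integral_const_mul]
        simp only [Complex.ofReal_neg, neg_mul, mul_neg, neg_neg]
        ring
    _ = (Real.sqrt (2 * Real.pi) : ℂ)⁻¹ * ∫ y, ∫ k : ℝ,
          ft g k * stepMultiplier ε k * (f y * Complex.exp (Complex.I * k * x y)) := by
        rw [integral_const_mul, integral_integral_swap hint]
    _ = _ := by
        rw [← integral_const_mul]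
        congr 1; funext y
        rw [integral_mul_stepKernel h0 h1 hg, mul_left_comm, ← integral_const_mul (f y)]
        congr 2; funext k
        ring

/-- In position space, `⟨g̃*, Bf̃⟩` pairs `f` with the primitive of `g` along `x`. -/
theorem Bip_eq_integral {x : ℝ → ℝ} (hx : Measurable x) {f g : ℝ → ℂ} (hf : Integrable f)
    (hg : Integrable g) (hgp : ∀ᵐ k : ℝ, k ≤ 0 → ft g k = 0)
    (hint : IntegrableOn (fun k : ℝ => ft g k * Fk x f (-k) / (2 * (k : ℂ))) (Ioi 0)) :
    Bip x g f = Complex.I / 2 * ∫ y, f y * ∫ t in Iio (x y), g t := by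
  have hR : Tendsto (fun ε => Complex.I / 2 * ∫ y, f y * ∫ t, g t * stepKernel ε (x y - t))
      (𝓝[>] 0) (𝓝 (Complex.I / 2 * ∫ y, f y * ∫ t in Iio (x y), g t)) := by
    refine Tendsto.const_mul _ ?_
    refine tendsto_integral_filter_of_dominated_convergence
      (fun y => ‖f y‖ * ((∫ t, ‖g t‖) * 2)) ?_ ?_ (hf.norm.mul_const _)
      (ae_of_all _ fun y => (tendsto_integral_mul_stepKernel hg _).const_mul _)
    · filter_upwards [eventually_nhdsGT_zero_le_half] with ε hε
      refine hf.1.mul ?_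
      have hc : Continuous fun s : ℝ => ∫ t, g t * stepKernel ε (s - t) := by
        refine continuous_of_dominated (bound := fun t => ‖g t‖ * 2) ?_ ?_
          (hg.norm.mul_const 2) ?_
        · exact fun s => hg.1.mul (Complex.continuous_ofReal.comp ((continuous_stepKernel ε).comp
            (continuous_const.sub continuous_id))).aestronglyMeasurable
        · refine fun s => ae_of_all _ fun t => ?_
          rw [norm_mul, Complex.norm_real]
          gcongr
          exact abs_stepKernel_le hε.1 hε.2 _
        · exact ae_of_all _ fun t => continuous_const.mul (Complex.continuous_ofReal.comp
            ((continuous_stepKernel ε).comp (continuous_id.sub continuous_const)))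
      exact (hc.measurable.comp hx).aestronglyMeasurable
    · filter_upwards [eventually_nhdsGT_zero_le_half] with ε hε
      refine ae_of_all _ fun y => ?_
      rw [norm_mul]
      gcongr
      exact norm_integral_mul_stepKernel_le hε.1 hε.2 hg _
  have hL : Tendsto (fun ε => ∫ k in Ioi (0 : ℝ), Complex.I * k * stepMultiplier ε k *
      (ft g k * Fk x f (-k) / (2 * (k : ℂ)))) (𝓝[>] 0) (𝓝 (Bip x g f)) := by
    refine tendsto_integral_filter_of_dominated_convergence
      (fun k => ‖ft g k * Fk x f (-k) / (2 * (k : ℂ))‖) ?_ ?_ hint.norm ?_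
    · filter_upwards [eventually_nhdsGT_zero_le_half] with ε hε
      refine AEStronglyMeasurable.mul ?_ hint.1
      have := continuous_stepMultiplier hε.1
      exact Continuous.aestronglyMeasurable (by fun_prop)
    · refine Eventually.of_forall fun ε => ?_
      filter_upwards [ae_restrict_mem measurableSet_Ioi] with k hk
      have hk : 0 < k := hk
      rw [norm_mul]
      refine mul_le_of_le_one_left (norm_nonneg _) ?_
      rw [norm_mul, norm_mul, Complex.norm_I, one_mul, Complex.norm_real, Real.norm_eq_abs]
      calc |k| * ‖stepMultiplier ε k‖ ≤ |k| * |k|⁻¹ := by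
            gcongr; exact norm_stepMultiplier_le ε hk.ne'
        _ = 1 := mul_inv_cancel₀ (abs_pos.2 hk.ne').ne'
    · filter_upwards [ae_restrict_mem measurableSet_Ioi] with k hk
      have hk : 0 < k := hk
      have hne : Complex.I * (k : ℂ) ≠ 0 := by simp [hk.ne']
      have := ((tendsto_stepMultiplier hk.ne').const_mul (Complex.I * (k : ℂ))).mul_const
        (ft g k * Fk x f (-k) / (2 * (k : ℂ)))
      rwa [mul_inv_cancel₀ hne, one_mul] at this
  refine tendsto_nhds_unique (hL.congr' ?_) hR
  filter_upwards [eventually_nhdsGT_zero_le_half] with ε hε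
  rw [← integral_ft_mul_stepMultiplier_mul_Fk hε.1 hε.2 hx hf hg, ← integral_const_mul,
    ← integral_indicator measurableSet_Ioi]
  refine integral_congr_ae ?_
  filter_upwards [hgp] with k hk
  by_cases h : 0 < k
  · have : (k : ℂ) ≠ 0 := by exact_mod_cast h.ne'
    rw [indicator_of_mem (mem_Ioi.2 h)]
    field_simp
  · simp [hk (not_lt.1 h), h]

theorem enorm_Bip_le {x : ℝ → ℝ} (hx : Measurable x) (hx0 : ∀ y, x y < 0)
    (ha : ∀ t < 0, ∃ a, ∀ y, t < x y ↔ a < y) {f g : ℝ → ℂ} (hf : Integrable f)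
    (hg : Integrable g) (hgp : ∀ᵐ k : ℝ, k ≤ 0 → ft g k = 0) {K : ℝ≥0∞}
    (hK : ∀ a, ‖∫ y in Ioi a, f y‖ₑ ≤ K) :
    ‖Bip x g f‖ₑ ≤ 2⁻¹ * ((∫⁻ t in Iio (0 : ℝ), ‖g t‖ₑ) * K) := by
  by_cases hint : IntegrableOn (fun k : ℝ => ft g k * Fk x f (-k) / (2 * (k : ℂ))) (Ioi 0)
  · rw [Bip_eq_integral hx hf hg hgp hint, enorm_mul]
    have h2 : ‖Complex.I / 2‖ₑ = 2⁻¹ := by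
      rw [← ofReal_norm]
      simp
    rw [h2]
    gcongr
    exact enorm_integral_mul_integral_Iio_le hx hx0 ha hf hg hK
  · rw [Bip, integral_undef hint]
    simp

theorem Aip_eq_conj_Bip (x : ℝ → ℝ) (g f : ℝ → ℂ) :
    Aip x g f = (starRingEnd ℂ) (Bip x g fun y => (starRingEnd ℂ) (f y)) := by
  rw [Aip, Bip, ← integral_conj]
  congr 1; funext k
  have : Fk x f k = (starRingEnd ℂ) (Fk x (fun y => (starRingEnd ℂ) (f y)) (-k)) := by
    rw [Fk, Fk, map_mul, ← integral_conj]
    simp [← Complex.exp_conj]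
  rw [this]
  simp [Complex.conj_ofNat]

theorem enorm_Aip_le {x : ℝ → ℝ} (hx : Measurable x) (hx0 : ∀ y, x y < 0)
    (ha : ∀ t < 0, ∃ a, ∀ y, t < x y ↔ a < y) {f g : ℝ → ℂ} (hf : Integrable f)
    (hg : Integrable g) (hgp : ∀ᵐ k : ℝ, k ≤ 0 → ft g k = 0) {K : ℝ≥0∞}
    (hK : ∀ a, ‖∫ y in Ioi a, f y‖ₑ ≤ K) :
    ‖Aip x g f‖ₑ ≤ 2⁻¹ * ((∫⁻ t in Iio (0 : ℝ), ‖g t‖ₑ) * K) := by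
  rw [Aip_eq_conj_Bip, RCLike.enorm_conj]
  refine enorm_Bip_le hx hx0 ha ?_ hg hgp fun a => ?_
  · exact (LinearIsometryEquiv.integrable_comp_iff Complex.conjLIE).2 hf
  · rw [integral_conj, RCLike.enorm_conj]
    exact hK a

theorem lt_xR_iff {t : ℝ} (ht : t < 0) (y : ℝ) : t < xR y ↔ -Real.log (-t) < y := by
  rw [xR, lt_neg, ← Real.lt_log_iff_exp_lt (by linarith), neg_lt]

theorem lt_xC_iff {t : ℝ} (ht : t < 0) (y : ℝ) :
    t < xC y ↔ -Real.log (Real.exp (-t) - 1) < y := by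
  have h1 : 0 < Real.exp (-t) - 1 := by
    have := Real.one_lt_exp_iff.2 (neg_pos.2 ht)
    linarith
  rw [xC, lt_neg, Real.log_lt_iff_lt_exp (by positivity), neg_lt,
    Real.lt_log_iff_exp_lt h1, lt_sub_iff_add_lt']

theorem xC_neg (y : ℝ) : xC y < 0 :=
  neg_neg_of_pos (Real.log_pos (by have := Real.exp_pos (-y); linarith))

/-- For `x = x_R` or `x = x_C`, a normalized outgoing wave function `f`
and a normalized incoming wave function `g`,
`|⟨g̃,Af̃⟩|² + |⟨g̃*,Bf̃⟩|² ≤ (1/π)(∫_{-∞}^0 |g|)²(∫_0^∞ |f̂(p)|/(2p) dp)²`,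
i.e. `|N̄_g[f] - N̄_o[f]|` satisfies the same bound. -/
theorem stmt_10 (x : ℝ → ℝ) (hx : x = xR ∨ x = xC) (f g : ℝ → ℂ)
    (hf : MeasureTheory.Integrable f)
    (hfp : ∀ᵐ p : ℝ, p ≤ 0 → ft f p = 0)
    (hfn : (∫⁻ p in Set.Ioi (0:ℝ),
        ENNReal.ofReal (‖ft f p‖ ^ 2 / (2 * p))) = 1)
    (hg : MeasureTheory.Integrable g)
    (hgp : ∀ᵐ k : ℝ, k ≤ 0 → ft g k = 0)
    (hgn : (∫⁻ k in Set.Ioi (0:ℝ),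
        ENNReal.ofReal (‖ft g k‖ ^ 2 / (2 * k))) = 1) :
    ENNReal.ofReal (‖Aip x g f‖ ^ 2 + ‖Bip x g f‖ ^ 2) ≤
      ENNReal.ofReal (1 / Real.pi) *
        (∫⁻ t in Set.Iio (0:ℝ), ENNReal.ofReal ‖g t‖) ^ 2 *
        (∫⁻ p in Set.Ioi (0:ℝ), ENNReal.ofReal (‖ft f p‖ / (2 * p))) ^ 2 ∧
    Ng x g f - No x f ≤
      ENNReal.ofReal (1 / Real.pi) *
        (∫⁻ t in Set.Iio (0:ℝ), ENNReal.ofReal ‖g t‖) ^ 2 *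
        (∫⁻ p in Set.Ioi (0:ℝ), ENNReal.ofReal (‖ft f p‖ / (2 * p))) ^ 2 := by
  obtain ⟨hxm, hx0, ha⟩ : Measurable x ∧ (∀ y, x y < 0) ∧
      ∀ t < 0, ∃ a, ∀ y, t < x y ↔ a < y := by
    rcases hx with rfl | rfl
    · exact ⟨by unfold xR; fun_prop, fun y => neg_neg_of_pos (Real.exp_pos _),
        fun t ht => ⟨_, lt_xR_iff ht⟩⟩
    · exact ⟨by unfold xC; fun_prop, xC_neg, fun t ht => ⟨_, lt_xC_iff ht⟩⟩
  have hK := enorm_integral_Ioi_le hf hfp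
  have hA := enorm_Aip_le hxm hx0 ha hf hg hgp hK
  have hB := enorm_Bip_le hxm hx0 ha hf hg hgp hK
  simp only [ofReal_norm]
  set G := ∫⁻ t in Set.Iio (0:ℝ), ‖g t‖ₑ
  set J := ∫⁻ p in Set.Ioi (0:ℝ), ENNReal.ofReal (‖ft f p‖ / (2 * p))
  set c := ENNReal.ofReal (Real.sqrt (2 * Real.pi))⁻¹ with hc
  have hcc : 2 * c ^ 2 = ENNReal.ofReal (1 / Real.pi) := by
    rw [hc, ← ENNReal.ofReal_pow (by positivity), inv_pow, Real.sq_sqrt (by positivity),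
      ← ENNReal.ofReal_ofNat 2, ← ENNReal.ofReal_mul (by norm_num)]
    congr 1
    field_simp
  have h2 : (2⁻¹ : ℝ≥0∞) * (G * (c * (2 * J))) = G * c * J := by
    rw [show (2⁻¹ : ℝ≥0∞) * (G * (c * (2 * J))) = (2⁻¹ * 2) * (G * c * J) by ring,
      ENNReal.inv_mul_cancel (by simp) (by simp), one_mul]
  rw [h2] at hA hB
  have key : ENNReal.ofReal (‖Aip x g f‖ ^ 2) + ENNReal.ofReal (‖Bip x g f‖ ^ 2) ≤
      ENNReal.ofReal (1 / Real.pi) * G ^ 2 * J ^ 2 := by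
    rw [ENNReal.ofReal_pow (norm_nonneg _), ENNReal.ofReal_pow (norm_nonneg _),
      ofReal_norm, ofReal_norm, ← hcc]
    calc ‖Aip x g f‖ₑ ^ 2 + ‖Bip x g f‖ₑ ^ 2 ≤ (G * c * J) ^ 2 + (G * c * J) ^ 2 := by gcongr
      _ = 2 * c ^ 2 * G ^ 2 * J ^ 2 := by ring
  refine ⟨?_, ?_⟩
  · rwa [ENNReal.ofReal_add (by positivity) (by positivity)]
  · rw [Ng, add_assoc]
    exact tsub_le_iff_left.2 (add_le_add_right key _)
end

section
/- Let x be either the relativistic map x_R(y) = −e^{−y} or the CGHS map x_C(y) = −log(1 + e^{−y}). Let f and g be Schwartz functions whose Fourier transforms vanish for all momenta ≤ 0, and set ǧ(y) = x′(y) g(x(y)). Then ∫_0^∞ conj(ĝ(k)) F̌(k)/(2k) dk = ∫_0^∞ conj(ǧ̂(p)) f̂(p)/(2p) dp. -/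
open MeasureTheory Set Filter
open scoped ENNReal

/-- The outgoing function `ǧ(y) = x'(y) g(x(y))` associated with an incoming `g`. -/
noncomputable def gout (x : ℝ → ℝ) (g : ℝ → ℂ) (y : ℝ) : ℂ :=
  ((deriv x y : ℝ) : ℂ) * g (x y)

open scoped FourierTransform ComplexConjugate

theorem ft_eq_fourier (f : ℝ → ℂ) (s : ℝ) :
    ft f (2 * Real.pi * s) = (Real.sqrt (2 * Real.pi) : ℂ)⁻¹ * 𝓕 f s := by
  rw [ft, Real.fourier_eq']
  congr 1
  refine integral_congr_ae (Eventually.of_forall fun y => ?_)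
  simp only [smul_eq_mul]
  rw [mul_comm]
  congr 2
  simp
  ring

theorem fourier_eq_zero_of_ft {f : ℝ → ℂ} (hf : ∀ p : ℝ, p ≤ 0 → ft f p = 0) {s : ℝ}
    (hs : s ≤ 0) : 𝓕 f s = 0 := by
  have h := hf (2 * Real.pi * s) (mul_nonpos_of_nonneg_of_nonpos (by positivity) hs)
  rw [ft_eq_fourier] at h
  refine (mul_eq_zero.1 h).resolve_left (inv_ne_zero ?_)
  exact_mod_cast (Real.sqrt_pos.2 (by positivity : 0 < 2 * Real.pi)).ne'

/-- A Schwartz function vanishing at the origin remains integrable after division by `s`. -/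
theorem SchwartzMap.integrable_div_of_map_zero (φ : SchwartzMap ℝ ℂ) (h0 : φ 0 = 0) :
    Integrable fun s : ℝ => φ s / (s : ℂ) := by
  obtain ⟨C, -, hC⟩ := φ.decay 0 1
  have hlip : ∀ s : ℝ, ‖φ s‖ ≤ C * |s| := fun s => by
    have := Convex.norm_image_sub_le_of_norm_deriv_le (𝕜 := ℝ) (f := φ) (s := univ) (x := 0)
      (y := s) (C := C) (fun y _ => φ.differentiableAt)
      (fun y _ => by simpa [norm_iteratedFDeriv_eq_norm_iteratedDeriv] using hC y)
      convex_univ (mem_univ _) (mem_univ _)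
    simpa [h0] using this
  have hmeas : AEStronglyMeasurable (fun s : ℝ => φ s / (s : ℂ)) volume :=
    (φ.continuous.measurable.div Complex.continuous_ofReal.measurable).aestronglyMeasurable
  have hind : Integrable ((Icc (-1 : ℝ) 1).indicator fun _ => C) :=
    (integrable_indicator_iff measurableSet_Icc).2 (integrableOn_const (by simp))
  refine (hind.add φ.integrable.norm).mono' hmeas (Eventually.of_forall fun s => ?_)
  have hCs : 0 ≤ C := (by positivity : (0 : ℝ) ≤ _).trans (hC 0)
  rw [norm_div, Complex.norm_real, Real.norm_eq_abs, Pi.add_apply]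
  by_cases hs : s ∈ Icc (-1 : ℝ) 1
  · rw [indicator_of_mem hs]
    exact (div_le_of_le_mul₀ (abs_nonneg _) hCs (hlip s)).trans
      (le_add_of_nonneg_right (norm_nonneg _))
  · rw [indicator_of_notMem hs, zero_add]
    refine div_le_self (norm_nonneg _) ?_
    by_contra! h
    exact hs (abs_le.1 h.le)

/-- The primitive of `2πi f` with spectrum `f̂(s) / s`. -/
noncomputable def spectralPrimitive (f : ℝ → ℂ) : ℝ → ℂ :=
  𝓕⁻ fun s : ℝ => 𝓕 f s / (s : ℂ)

section SpectralPrimitive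

variable (f : SchwartzMap ℝ ℂ)

theorem integrable_fourier_div (h0 : 𝓕 (f : ℝ → ℂ) 0 = 0) :
    Integrable fun s : ℝ => 𝓕 (f : ℝ → ℂ) s / (s : ℂ) := by
  rw [← SchwartzMap.fourier_coe] at h0 ⊢
  exact (𝓕 f).integrable_div_of_map_zero h0

theorem hasDerivAt_spectralPrimitive (h0 : 𝓕 (f : ℝ → ℂ) 0 = 0) (y : ℝ) :
    HasDerivAt (spectralPrimitive f) (2 * Real.pi * Complex.I * f y) y := by
  have hmul (s : ℝ) : (s : ℂ) * (𝓕 (f : ℝ → ℂ) s / s) = 𝓕 (f : ℝ → ℂ) s := by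
    rcases eq_or_ne s 0 with rfl | hs
    · simp [h0]
    · field_simp [Complex.ofReal_ne_zero.2 hs]
  have hint : Integrable (𝓕 (f : ℝ → ℂ)) := by
    rw [← SchwartzMap.fourier_coe]
    exact (𝓕 f).integrable
  have hd := Real.hasDerivAt_fourier (integrable_fourier_div f h0)
    (by simpa only [Complex.real_smul, hmul] using hint) (-y)
  have hval : 𝓕 (fun s : ℝ => (-2 * (Real.pi : ℂ) * Complex.I * (s : ℂ)) •
      (𝓕 (f : ℝ → ℂ) s / (s : ℂ))) (-y) = -2 * Real.pi * Complex.I * f y := by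
    have : (fun s : ℝ => (-2 * (Real.pi : ℂ) * Complex.I * (s : ℂ)) •
        (𝓕 (f : ℝ → ℂ) s / (s : ℂ))) =
        (-2 * (Real.pi : ℂ) * Complex.I) • 𝓕 (f : ℝ → ℂ) := by
      ext s
      simp only [smul_eq_mul, Pi.smul_apply, mul_assoc, hmul]
    rw [this]
    refine (congrFun (VectorFourier.fourierIntegral_const_smul _ _ _ _ _) _).trans ?_
    change (-2 * (Real.pi : ℂ) * Complex.I) • 𝓕 (𝓕 (f : ℝ → ℂ)) (-y) = _
    rw [← Real.fourierInv_eq_fourier_neg,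
      f.continuous.fourierInv_fourier_eq f.integrable hint, smul_eq_mul]
  rw [hval] at hd
  have hcomp := hd.scomp y (hasDerivAt_neg y)
  have hfun : spectralPrimitive f =
      𝓕 (fun s : ℝ => 𝓕 (f : ℝ → ℂ) s / (s : ℂ)) ∘ Neg.neg := by
    ext z
    exact Real.fourierInv_eq_fourier_neg _ z
  rw [hfun]
  exact hcomp.congr_deriv (by simp)

theorem norm_spectralPrimitive_le (f : ℝ → ℂ) (y : ℝ) :
    ‖spectralPrimitive f y‖ ≤ ∫ s : ℝ, ‖𝓕 f s / (s : ℂ)‖ := by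
  rw [spectralPrimitive, Real.fourierInv_eq_fourier_neg]
  exact VectorFourier.norm_fourierIntegral_le_integral_norm _ _ _ _ _

theorem tendsto_spectralPrimitive_cocompact (f : ℝ → ℂ) :
    Tendsto (spectralPrimitive f) (cocompact ℝ) (nhds 0) := by
  have h := (Real.zero_at_infty_fourier fun s : ℝ => 𝓕 f s / (s : ℂ)).comp
    (Homeomorph.neg ℝ).isClosedEmbedding.tendsto_cocompact
  refine h.congr fun y => ?_
  exact (Real.fourierInv_eq_fourier_neg _ y).symm

end SpectralPrimitive

theorem integral_mul_integral_exp_swap {u v : ℝ → ℂ} (hu : Integrable u) (hv : Integrable v)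
    {x : ℝ → ℝ} (hx : Continuous x) :
    ∫ s, u s * ∫ y, v y * Complex.exp (-Complex.I * ((2 * Real.pi * s : ℝ) : ℂ) * (x y : ℂ)) =
      ∫ y, v y *
        ∫ s, u s * Complex.exp (-Complex.I * ((2 * Real.pi * s : ℝ) : ℂ) * (x y : ℂ)) := by
  simp_rw [← integral_const_mul]
  rw [integral_integral_swap]
  · simp_rw [mul_left_comm]
  · have h := (hu.mul_prod hv).bdd_mul (c := 1) (f := fun z : ℝ × ℝ =>
      Complex.exp (-Complex.I * ((2 * Real.pi * z.1 : ℝ) : ℂ) * (x z.2 : ℂ)))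
      (by fun_prop) (Eventually.of_forall fun z => by simp [Complex.norm_exp])
    refine h.congr (Eventually.of_forall fun z => ?_)
    simp only [Function.uncurry]
    ring

theorem integral_ft_mul_Fk (a : SchwartzMap ℝ ℂ) (ha : ∀ k : ℝ, k ≤ 0 → ft a k = 0)
    {h : ℝ → ℂ} (hh : Integrable h) {x : ℝ → ℝ} (hx : Continuous x) :
    ∫ k in Ioi (0 : ℝ), ft a k * Fk x h k / (2 * (k : ℂ)) =
      ((4 * Real.pi : ℝ) : ℂ)⁻¹ * ∫ y, h y * spectralPrimitive a (-x y) := by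
  have hprim (y : ℝ) : spectralPrimitive a (-x y) = ∫ s : ℝ, 𝓕 (a : ℝ → ℂ) s / (s : ℂ) *
      Complex.exp (-Complex.I * ((2 * Real.pi * s : ℝ) : ℂ) * (x y : ℂ)) := by
    rw [spectralPrimitive, Real.fourierInv_eq_fourier_neg, neg_neg, Real.fourier_eq']
    refine integral_congr_ae (Eventually.of_forall fun s => ?_)
    simp only [smul_eq_mul]
    rw [mul_comm]
    congr 2
    simp
    ring
  have hpi : (0 : ℝ) < 2 * Real.pi := by positivity
  simp_rw [hprim]
  rw [← integral_mul_integral_exp_swap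
      (integrable_fourier_div a (fourier_eq_zero_of_ft ha le_rfl)) hh hx,
    setIntegral_eq_integral_of_forall_compl_eq_zero
      (fun k hk => by simp [ha k (not_lt.1 hk)])]
  have hscale := Measure.integral_comp_mul_left
    (fun k : ℝ => ft a k * Fk x h k / (2 * (k : ℂ))) (2 * Real.pi)
  rw [abs_of_pos (inv_pos.2 hpi), eq_inv_smul_iff₀ hpi.ne'] at hscale
  rw [← hscale, ← integral_smul, ← integral_const_mul]
  refine integral_congr_ae (Eventually.of_forall fun s => ?_)
  have hsq : (Real.sqrt (2 * Real.pi) : ℂ)⁻¹ * (Real.sqrt (2 * Real.pi) : ℂ)⁻¹ =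
      ((2 * Real.pi : ℝ) : ℂ)⁻¹ := by
    rw [← mul_inv, ← Complex.ofReal_mul, Real.mul_self_sqrt hpi.le]
  have hpi' : (Real.pi : ℂ) ≠ 0 := Complex.ofReal_ne_zero.2 Real.pi_ne_zero
  simp only [ft_eq_fourier, Fk, Complex.real_smul]
  generalize (∫ y, h y * Complex.exp (-Complex.I * ((2 * Real.pi * s : ℝ) : ℂ) * (x y : ℂ))) = J
  rw [mul_mul_mul_comm, hsq]
  push_cast
  field_simp
  ring

theorem Fk_neg_conj (x : ℝ → ℝ) (f : ℝ → ℂ) (k : ℝ) :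
    Fk (fun y => -x y) (fun y => conj (f y)) k = conj (Fk x f k) := by
  simp only [Fk, map_mul, map_inv₀, Complex.conj_ofReal, ← integral_conj, ← Complex.exp_conj]
  simp

theorem conj_ft (f : ℝ → ℂ) (p : ℝ) :
    conj (ft f p) = Fk (fun y => -y) (fun y => conj (f y)) p :=
  (Fk_neg_conj id f p).symm

theorem integrable_gout {x : ℝ → ℝ} (hx : ∀ y, 0 < deriv x y) {g : ℝ → ℂ}
    (hg : Integrable g) : Integrable (gout x g) := by
  have hdiff (y : ℝ) : DifferentiableAt ℝ x y := differentiableAt_of_deriv_ne_zero (hx y).ne'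
  have h := (integrableOn_image_iff_integrableOn_abs_deriv_smul MeasurableSet.univ
    (fun y _ => (hdiff y).hasDerivAt.hasDerivWithinAt)
    (strictMono_of_deriv_pos hx).injective.injOn g).1 hg.integrableOn
  rw [integrableOn_univ] at h
  refine h.congr (Eventually.of_forall fun y => ?_)
  simp only [gout, abs_of_pos (hx y), Complex.real_smul]

theorem integral_mul_conj_gout {x : ℝ → ℝ} (hx : ∀ y, 0 < deriv x y) (f g : SchwartzMap ℝ ℂ)
    (hf : 𝓕 (f : ℝ → ℂ) 0 = 0) (hg : 𝓕 (g : ℝ → ℂ) 0 = 0) :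
    ∫ y, spectralPrimitive f y * conj (gout x g y) =
      ∫ y, f y * conj (spectralPrimitive g (x y)) := by
  have hdiff (y : ℝ) : DifferentiableAt ℝ x y := differentiableAt_of_deriv_ne_zero (hx y).ne'
  have hF := hasDerivAt_spectralPrimitive f hf
  have hG (y : ℝ) : HasDerivAt (fun y => conj (spectralPrimitive g (x y)))
      (-(2 * Real.pi * Complex.I) * conj (gout x g y)) y := by
    have h := ((hasDerivAt_spectralPrimitive g hg (x y)).scomp y (hdiff y).hasDerivAt).star
    refine h.congr_deriv ?_
    simp only [gout, RCLike.star_def, Complex.real_smul, map_mul, map_ofNat,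
      Complex.conj_ofReal, Complex.conj_I]
    ring
  have hFc : Continuous (spectralPrimitive f) :=
    continuous_iff_continuousAt.2 fun y => (hF y).continuousAt
  have hGc : Continuous fun y => conj (spectralPrimitive g (x y)) :=
    continuous_iff_continuousAt.2 fun y => (hG y).continuousAt
  have hGb (y : ℝ) : ‖conj (spectralPrimitive g (x y))‖ ≤
      ∫ s : ℝ, ‖𝓕 (g : ℝ → ℂ) s / (s : ℂ)‖ := by
    rw [RCLike.norm_conj]
    exact norm_spectralPrimitive_le g (x y)
  have hprod : Tendsto (spectralPrimitive f * fun y => conj (spectralPrimitive g (x y)))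
      (cocompact ℝ) (nhds 0) :=
    (tendsto_spectralPrimitive_cocompact f).zero_mul_isBoundedUnder_le
      (isBoundedUnder_of ⟨_, hGb⟩)
  have hgi : Integrable fun y => conj (gout x g y) :=
    Complex.conjCLE.toContinuousLinearMap.integrable_comp (integrable_gout hx g.integrable)
  have hparts := integral_mul_deriv_eq_deriv_mul (fun y _ => hF y) (fun y _ => hG y)
    ((hgi.const_mul _).bdd_mul hFc.aestronglyMeasurable
      (Eventually.of_forall (norm_spectralPrimitive_le f)))
    ((f.integrable.const_mul _).mul_bdd hGc.aestronglyMeasurable (Eventually.of_forall hGb))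
    (hprod.mono_left atBot_le_cocompact) (hprod.mono_left atTop_le_cocompact)
  have hl (y : ℝ) : spectralPrimitive f y * (-(2 * Real.pi * Complex.I) * conj (gout x g y)) =
      -(2 * Real.pi * Complex.I) * (spectralPrimitive f y * conj (gout x g y)) := mul_left_comm ..
  simp only [hl, mul_assoc (2 * (Real.pi : ℂ) * Complex.I) (f _), integral_const_mul, sub_zero,
    zero_sub] at hparts
  rw [neg_mul, neg_inj] at hparts
  exact mul_left_cancel₀ Complex.two_pi_I_ne_zero hparts

theorem integral_conj_ft_mul_Fk {x : ℝ → ℝ} (hx : ∀ y, 0 < deriv x y) (f g : SchwartzMap ℝ ℂ)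
    (hfp : ∀ p : ℝ, p ≤ 0 → ft f p = 0) (hgp : ∀ k : ℝ, k ≤ 0 → ft g k = 0) :
    ∫ k in Ioi (0 : ℝ), conj (ft g k) * Fk x f k / (2 * (k : ℂ)) =
      ∫ p in Ioi (0 : ℝ), conj (ft (gout x g) p) * ft f p / (2 * (p : ℂ)) := by
  have hxc : Continuous x := continuous_iff_continuousAt.2 fun y =>
    (differentiableAt_of_deriv_ne_zero (hx y).ne').continuousAt
  have hin : ∫ k in Ioi (0 : ℝ), conj (ft g k) * Fk x f k / (2 * (k : ℂ)) =
      ((4 * Real.pi : ℝ) : ℂ)⁻¹ * ∫ y, f y * conj (spectralPrimitive g (x y)) := by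
    have h := congrArg conj (integral_ft_mul_Fk g hgp
      (Complex.conjCLE.toContinuousLinearMap.integrable_comp f.integrable) hxc.neg)
    rw [map_mul, ← integral_conj, ← integral_conj] at h
    have hk (k : ℝ) : Fk (-x) (fun y => conj (f y)) k = conj (Fk x f k) := Fk_neg_conj x f k
    simpa [hk, Complex.conj_ofNat] using h
  have hout : ∫ p in Ioi (0 : ℝ), conj (ft (gout x g) p) * ft f p / (2 * (p : ℂ)) =
      ((4 * Real.pi : ℝ) : ℂ)⁻¹ * ∫ y, spectralPrimitive f y * conj (gout x g y) := by
    have h := integral_ft_mul_Fk f hfp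
      (Complex.conjCLE.toContinuousLinearMap.integrable_comp (integrable_gout hx g.integrable))
      (x := fun y => -y) continuous_neg
    simp only [neg_neg] at h
    simp only [conj_ft, mul_comm _ (ft f _), mul_comm (spectralPrimitive f _)]
    exact h
  rw [hin, hout, integral_mul_conj_gout hx f g (fourier_eq_zero_of_ft hfp le_rfl)
    (fourier_eq_zero_of_ft hgp le_rfl)]

theorem deriv_xR_pos (y : ℝ) : 0 < deriv xR y := by
  have h : HasDerivAt xR (Real.exp (-y)) y := by
    exact ((hasDerivAt_neg y).exp).neg.congr_deriv (by simp)
  rw [h.deriv]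
  positivity

theorem deriv_xC_pos (y : ℝ) : 0 < deriv xC y := by
  have hpos : 0 < 1 + Real.exp (-y) := by positivity
  have h : HasDerivAt xC (Real.exp (-y) / (1 + Real.exp (-y))) y := by
    exact ((((hasDerivAt_neg y).exp).const_add 1).log hpos.ne').neg.congr_deriv (by ring)
  rw [h.deriv]
  positivity

/-- For `x = x_R` or `x = x_C` and Schwartz functions `f, g` of
positive-frequency type, `∫_0^∞ conj(ĝ(k)) F̌(k)/(2k) dk
  = ∫_0^∞ conj(ǧ̂(p)) f̂(p)/(2p) dp` with `ǧ(y) = x'(y)g(x(y))`. -/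
theorem stmt_11 (x : ℝ → ℝ) (hx : x = xR ∨ x = xC) (f g : SchwartzMap ℝ ℂ)
    (hfp : ∀ p : ℝ, p ≤ 0 → ft (⇑f) p = 0)
    (hgp : ∀ k : ℝ, k ≤ 0 → ft (⇑g) k = 0) :
    (∫ k in Set.Ioi (0:ℝ),
        (starRingEnd ℂ) (ft (⇑g) k) * Fk x (⇑f) k / (2 * (k : ℂ))) =
      ∫ p in Set.Ioi (0:ℝ),
        (starRingEnd ℂ) (ft (gout x (⇑g)) p) * ft (⇑f) p / (2 * (p : ℂ)) := by
  rcases hx with rfl | rfl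
  · exact integral_conj_ft_mul_Fk deriv_xR_pos f g hfp hgp
  · exact integral_conj_ft_mul_Fk deriv_xC_pos f g hfp hgp
end
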